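/- arXiv:1512.07955 — 3 statements merged into one kernel-verified Lean document; each statement's English description precedes it below -/
import Mathlib

section
/- Let β ∈ ℂ, M ≥ 1, N ≥ 1, and let v₁,…,v_N be nonzero complex numbers with v_j² ≠ v_k² for j ≠ k and v_j⁻² ≠ β for all j. For occupation numbers n₀,…,n_{M−1} ≥ 0 with n₀ + ⋯ + n_{M−1} = N, let λ = ((M−1)^{n_{M−1}}, …, 1^{n₁}, 0^{n₀}) be the corresponding partition. Then the phase-model wavefunctions satisfy ⟨{n}_{M,N}|Ψ({v}_N)⟩ = ∏_{j=1}^N (v_j⁻¹ − βv_j)^{M−1} G_λ(z₁,…,z_N;β) and ⟨Ψ({v}_N)|{n}_{M,N}⟩ = ∏_{j=1}^N (v_j⁻¹ − βv_j)^{M−1} G_{λ∨}(z₁,…,z_N;β), where z_j⁻¹ = v_j⁻² − β and λ∨_j = M − 1 − λ_{N+1−j}. -/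
noncomputable section

/-- The `M`-fold tensor power of the bosonic Fock space, with basis the occupation
configurations `Fin M → ℕ`. -/
abbrev FockM (M : ℕ) : Type := (Fin M → ℕ) →₀ ℂ

/-- The phase-model L-operator `𝓛(v) = [[v⁻¹ − βvπ, φ†],[φ, v]]` acting on the auxiliary
space and the `j`-th Fock factor of `𝓕^{⊗M}`, as a `2 × 2` operator-valued matrix. -/
def phaseLsite (M : ℕ) (β v : ℂ) (j : Fin M) :
    Matrix (Fin 2) (Fin 2) (Module.End ℂ (FockM M)) :=
  ![![Finsupp.lsum ℂ fun n => (v⁻¹ - β * v * (if n j = 0 then 1 else 0)) • Finsupp.lsingle n,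
      Finsupp.lsum ℂ fun n => Finsupp.lsingle (Function.update n j (n j + 1))],
    ![Finsupp.lsum ℂ fun n =>
        if n j = 0 then 0 else Finsupp.lsingle (Function.update n j (n j - 1)),
      Finsupp.lsum ℂ fun n => v • Finsupp.lsingle n]]

/-- The phase-model monodromy matrix `𝓣_a(v) = 𝓛_{a,M−1}(v) ⋯ 𝓛_{a,0}(v)`. -/
def phaseT (M : ℕ) (β v : ℂ) : Matrix (Fin 2) (Fin 2) (Module.End ℂ (FockM M)) :=
  ((List.ofFn fun j : Fin M => phaseLsite M β v j).reverse).prod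

/-- The phase-model `𝓑`-operator, the upper-right block of the monodromy matrix. -/
def phaseB (M : ℕ) (β v : ℂ) : Module.End ℂ (FockM M) := phaseT M β v 0 1

/-- The phase-model `𝓒`-operator, the lower-left block of the monodromy matrix. -/
def phaseC (M : ℕ) (β v : ℂ) : Module.End ℂ (FockM M) := phaseT M β v 1 0

/-- The Grothendieck polynomial
`G_λ(z;β) = det( z_j^{λ_k+N−k} (1+βz_j)^{k−1} ) / ∏_{j<k} (z_j − z_k)`. -/
def Groth (N : ℕ) (β : ℂ) (lam : Fin N → ℕ) (z : Fin N → ℂ) : ℂ :=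
  Matrix.det (Matrix.of fun j k : Fin N =>
      z j ^ (lam k + (N - 1 - (k : ℕ))) * (1 + β * z j) ^ (k : ℕ))
    / ∏ j : Fin N, ∏ k : Fin N, if j < k then z j - z k else 1

section GrothendieckWavefunctions

open Finset Matrix

/-- The geometric sum giving one column of the branching rule for Grothendieck polynomials. -/
lemma sub_mul_sum_interlacing (β x y : ℂ) {a b : ℕ} (h : b ≤ a) :
    (x - y) * ∑ m ∈ Icc b a, x ^ (a - m) * (if b < m then 1 + β * x else 1) * y ^ m
      = x ^ (a - b + 1) * y ^ b * (1 + β * y) - (1 + β * x) * y ^ (a + 1) := by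
  induction a, h using Nat.le_induction with
  | base => simp; ring
  | succ a hab ih =>
    have hx : ∑ m ∈ Icc b a, x ^ (a + 1 - m) * (if b < m then 1 + β * x else 1) * y ^ m
        = x * ∑ m ∈ Icc b a, x ^ (a - m) * (if b < m then 1 + β * x else 1) * y ^ m := by
      rw [mul_sum]
      refine sum_congr rfl fun m hm => ?_
      rw [Nat.succ_sub (mem_Icc.1 hm).2, pow_succ]
      ring
    rw [sum_Icc_succ_top (by omega), hx, mul_add, mul_left_comm, ih, Nat.succ_sub hab,
      if_pos (by omega)]
    simp
    ring

/-- The numerator of the Grothendieck polynomial. -/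
def grothMatrix (N : ℕ) (β : ℂ) (lam : Fin N → ℕ) (z : Fin N → ℂ) : Matrix (Fin N) (Fin N) ℂ :=
  of fun j k => z j ^ (lam k + (N - 1 - (k : ℕ))) * (1 + β * z j) ^ (k : ℕ)

/-- The weight of the interlacing pair `mu ≺ lam` in the branching rule. -/
def grothBranchWeight {N : ℕ} (β x : ℂ) (lam : Fin (N + 1) → ℕ) (mu : Fin N → ℕ) : ℂ :=
  x ^ lam (Fin.last N) * ∏ k, (x ^ (lam k.castSucc - mu k) *
    (if lam k.succ < mu k then 1 + β * x else 1))

/-- The sequences interlacing with `lam`. -/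
def interlacing {N : ℕ} (lam : Fin (N + 1) → ℕ) : Finset (Fin N → ℕ) :=
  Fintype.piFinset fun k => Icc (lam k.succ) (lam k.castSucc)

lemma sum_interlacing_det {N : ℕ} (β x : ℂ) (lam : Fin (N + 1) → ℕ) (y : Fin N → ℂ) :
    det (of fun j k : Fin N => (∑ m ∈ Icc (lam k.succ) (lam k.castSucc),
        x ^ (lam k.castSucc - m) * (if lam k.succ < m then 1 + β * x else 1) * y j ^ m)
          * (y j ^ (N - 1 - (k : ℕ)) * (1 + β * y j) ^ (k : ℕ)))
      = ∑ mu ∈ interlacing lam, (∏ k, (x ^ (lam k.castSucc - mu k) *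
          (if lam k.succ < mu k then 1 + β * x else 1))) * (grothMatrix N β mu y).det := by
  let g : Fin N → ℕ → Fin N → ℂ := fun k m j =>
    x ^ (lam k.castSucc - m) * (if lam k.succ < m then 1 + β * x else 1) *
      (y j ^ (m + (N - 1 - (k : ℕ))) * (1 + β * y j) ^ (k : ℕ))
  have h := (detRowAlternating (R := ℂ) (n := Fin N)).toMultilinearMap.map_sum_finset g
    (fun k => Icc (lam k.succ) (lam k.castSucc))
  rw [← det_transpose]
  convert h using 1
  · change _ = det (fun k => ∑ m ∈ Icc (lam k.succ) (lam k.castSucc), g k m)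
    congr 1
    ext k j
    simp only [transpose_apply, of_apply, sum_mul, Finset.sum_apply, g]
    refine sum_congr rfl fun m _ => ?_
    rw [pow_add]; ring
  · refine sum_congr rfl fun mu _ => ?_
    change _ = det (fun k => g k (mu k))
    rw [← det_transpose (grothMatrix _ _ _ _), ← det_mul_column]
    rfl

lemma grothMatrix_det_branching {N : ℕ} (β : ℂ) (lam : Fin (N + 1) → ℕ) (hlam : Antitone lam)
    (z : Fin (N + 1) → ℂ) (hz : 1 + β * z 0 ≠ 0) :
    (grothMatrix (N + 1) β lam z).det = (∏ j : Fin N, (z 0 - z j.succ)) *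
      ∑ mu ∈ interlacing lam,
        grothBranchWeight β (z 0) lam mu * (grothMatrix N β mu (fun j => z j.succ)).det := by
  set x := z 0 with hx
  set E := grothMatrix (N + 1) β lam z with hE
  let U : Matrix (Fin (N + 1)) (Fin (N + 1)) ℂ := of fun i => Fin.snoc
    (fun k : Fin N => if i = k.castSucc then -(1 + β * x) else
      if i = k.succ then x ^ (lam k.castSucc - lam k.succ + 1) else 0)
    (if i = Fin.last N then 1 else 0)
  have hU1 : ∀ i (k : Fin N), U i k.castSucc = if i = k.castSucc then -(1 + β * x) else
      if i = k.succ then x ^ (lam k.castSucc - lam k.succ + 1) else 0 := by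
    intro i k; simp [U]
  have hU2 : ∀ i, U i (Fin.last N) = if i = Fin.last N then 1 else 0 := by
    intro i; simp [U]
  have hUdet : U.det = (-(1 + β * x)) ^ N := by
    rw [det_of_isLowerTriangular U, Fin.prod_univ_castSucc]
    · simp [hU1, hU2]
    · intro i j hij
      have hij : i < j := hij
      induction j using Fin.lastCases with
      | last => rw [hU2, if_neg hij.ne]
      | cast k =>
        rw [hU1, if_neg hij.ne, if_neg]
        rintro rfl
        exact absurd hij (not_lt.2 k.castSucc_lt_succ.le)
  have hEU1 : ∀ j (k : Fin N), (E * U) j k.castSucc = (x - z j) *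
      (∑ m ∈ Icc (lam k.succ) (lam k.castSucc), x ^ (lam k.castSucc - m) *
        (if lam k.succ < m then 1 + β * x else 1) * z j ^ m) *
          (z j ^ (N - 1 - (k : ℕ)) * (1 + β * z j) ^ (k : ℕ)) := by
    intro j k
    rw [sub_mul_sum_interlacing β x (z j) (hlam k.castSucc_lt_succ.le), mul_apply,
      sum_eq_add_of_mem k.castSucc k.succ (mem_univ _) (mem_univ _) k.castSucc_lt_succ.ne]
    · have hk : N - k = N - 1 - k + 1 := by have := k.2; omega
      have hk' : N - (k + 1) = N - 1 - k := by omega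
      simp only [hU1, if_true, if_neg k.castSucc_lt_succ.ne', hE, grothMatrix, of_apply,
        Fin.val_castSucc, Fin.val_succ, Nat.add_sub_cancel, hk, hk', pow_add, pow_one]
      ring
    · rintro i - ⟨h1, h2⟩
      rw [hU1, if_neg h1, if_neg h2, mul_zero]
  have hEU2 : (E * U) 0 (Fin.last N) = x ^ lam (Fin.last N) * (1 + β * x) ^ N := by
    simp [mul_apply, hU2, hE, grothMatrix, hx]
  have hdet : E.det * (-(1 + β * x)) ^ N
      = (-1) ^ N * (x ^ lam (Fin.last N) * (1 + β * x) ^ N) *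
        ((∏ j : Fin N, (x - z j.succ)) * ∑ mu ∈ interlacing lam,
          (∏ k, (x ^ (lam k.castSucc - mu k) * (if lam k.succ < mu k then 1 + β * x else 1))) *
            (grothMatrix N β mu (fun j => z j.succ)).det) := by
    rw [← hUdet, ← det_mul, det_succ_row_zero, Fin.sum_univ_castSucc,
      sum_eq_zero fun k _ => by rw [hEU1, ← hx]; simp, zero_add, hEU2, Fin.succAbove_last,
      ← sum_interlacing_det, ← det_mul_column, Fin.val_last]
    congr 2
    ext j k
    simp [hEU1, mul_assoc]
  have hne : (-(1 + β * x)) ^ N ≠ 0 := pow_ne_zero _ (neg_ne_zero.2 hz)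
  apply mul_right_cancel₀ hne
  rw [hdet, neg_pow (1 + β * x)]
  simp only [grothBranchWeight, mul_sum, sum_mul]
  refine sum_congr rfl fun mu _ => ?_
  ring

lemma Groth_eq (N : ℕ) (β : ℂ) (lam : Fin N → ℕ) (z : Fin N → ℂ) :
    Groth N β lam z = (grothMatrix N β lam z).det /
      ∏ j : Fin N, ∏ k : Fin N, if j < k then z j - z k else 1 := rfl

/-- The branching rule for Grothendieck polynomials. -/
lemma Groth_branching {N : ℕ} (β : ℂ) (lam : Fin (N + 1) → ℕ) (hlam : Antitone lam)
    (z : Fin (N + 1) → ℂ) (hz : 1 + β * z 0 ≠ 0) (hinj : Function.Injective z) :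
    Groth (N + 1) β lam z = ∑ mu ∈ interlacing lam,
      grothBranchWeight β (z 0) lam mu * Groth N β mu (fun j => z j.succ) := by
  have hne : ∏ j : Fin N, (z 0 - z j.succ) ≠ 0 :=
    prod_ne_zero_iff.2 fun j _ => sub_ne_zero.2 fun h => (Fin.succ_ne_zero j) (hinj h).symm
  have hden : (∏ j : Fin (N + 1), ∏ k : Fin (N + 1), if j < k then z j - z k else 1)
      = (∏ j : Fin N, (z 0 - z j.succ)) *
        ∏ j : Fin N, ∏ k : Fin N, if j < k then z j.succ - z k.succ else 1 := by
    simp [Fin.prod_univ_succ]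
  rw [Groth_eq, hden, grothMatrix_det_branching β lam hlam z hz, mul_div_mul_left _ _ hne, sum_div]
  simp only [Groth_eq, mul_div_assoc]

/-- Grothendieck polynomials are symmetric. -/
lemma Groth_comp_perm (N : ℕ) (β : ℂ) (lam : Fin N → ℕ) (z : Fin N → ℂ)
    (σ : Equiv.Perm (Fin N)) : Groth N β lam (z ∘ σ) = Groth N β lam z := by
  have hden : ∀ y : Fin N → ℂ, (∏ j : Fin N, ∏ k : Fin N, if j < k then y j - y k else 1)
      = (vandermonde fun j => -y j).det := by
    intro y
    rw [det_vandermonde]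
    refine prod_congr rfl fun j _ => ?_
    rw [← prod_filter]
    refine prod_congr (by ext; simp) fun k _ => by ring
  rw [Groth_eq, Groth_eq, hden, hden,
    show grothMatrix N β lam (z ∘ σ) = (grothMatrix N β lam z).submatrix σ id from rfl,
    show (vandermonde fun j => -(z ∘ σ) j) = (vandermonde fun j => -z j).submatrix σ id from rfl,
    det_permute, det_permute, mul_div_mul_left]
  rcases Int.units_eq_one_or (Equiv.Perm.sign σ) with h | h <;> simp [h]

/-- The matrix elements `⟨a|𝓛(v)|b⟩` of the L-operator between Fock states. -/
def phaseW (β v : ℂ) (a b : ℕ) : Matrix (Fin 2) (Fin 2) ℂ :=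
  !![if a = b then v⁻¹ - β * v * (if b = 0 then 1 else 0) else 0, if a = b + 1 then 1 else 0;
    if a + 1 = b then 1 else 0, if a = b then v else 0]

lemma phaseW_transpose (β v : ℂ) (a b : ℕ) : (phaseW β v a b)ᵀ = phaseW β v b a := by
  ext i j
  fin_cases i <;> fin_cases j <;> simp [phaseW, eq_comm]
  refine ite_congr rfl (fun h => by rw [h]) fun _ => rfl

/-- Matrix elements of products of L-operators at distinct sites. -/
lemma prod_phaseLsite_apply (M : ℕ) (β v : ℂ) (n' : Fin M → ℕ) (l : List (Fin M))
    (hl : l.Nodup) (a b : Fin 2) (n : Fin M → ℕ) :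
    ((l.map (phaseLsite M β v)).reverse.prod a b (Finsupp.single n 1)) n' =
      if ∀ i, i ∉ l → n' i = n i then
        (l.map fun j => phaseW β v (n' j) (n j)).reverse.prod a b else 0 := by
  induction l generalizing a b n with
  | nil =>
    by_cases h : n' = n
    · subst h
      by_cases hab : a = b <;> simp [hab]
    · have h' : ¬ ∀ i, n' i = n i := fun h' => h (funext h')
      by_cases hab : a = b <;> simp [hab, h', Ne.symm h]
  | cons j l ih =>
    obtain ⟨hj, hl⟩ := List.nodup_cons.1 hl
    have key : ∀ c (m : ℕ),
        ((l.map (phaseLsite M β v)).reverse.prod a c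
          (Finsupp.single (Function.update n j m) 1)) n' =
        if n' j = m then (if ∀ i, i ∉ j :: l → n' i = n i then
        (l.map fun j => phaseW β v (n' j) (n j)).reverse.prod a c else 0) else 0 := by
      intro c m
      rw [ih hl]
      have hmap : (l.map fun i => phaseW β v (n' i) (Function.update n j m i))
          = l.map fun i => phaseW β v (n' i) (n i) := by
        refine List.map_congr_left fun i hi => ?_
        rw [Function.update_of_ne]
        rintro rfl; exact hj hi
      rw [hmap, ← ite_and]
      refine if_congr ?_ rfl rfl
      constructor
      · intro h
        refine ⟨by simpa using h j hj, fun i hi => ?_⟩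
        rw [List.mem_cons, not_or] at hi
        simpa [hi.1] using h i hi.2
      · rintro ⟨h1, h2⟩ i hi
        by_cases hij : i = j
        · subst hij; simpa using h1
        · simpa [hij] using h2 i (by simp [hij, hi])
    have key0 : ∀ c, ((l.map (phaseLsite M β v)).reverse.prod a c (Finsupp.single n 1)) n' =
        if n' j = n j then (if ∀ i, i ∉ j :: l → n' i = n i then
        (l.map fun j => phaseW β v (n' j) (n j)).reverse.prod a c else 0) else 0 := by
      intro c
      simpa using key c (n j)
    rw [List.map_cons, List.reverse_cons, List.prod_append, List.prod_singleton, List.map_cons,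
      List.reverse_cons, List.prod_append, List.prod_singleton, Matrix.mul_apply, Matrix.mul_apply,
      Fin.sum_univ_two, Fin.sum_univ_two, LinearMap.add_apply, Module.End.mul_apply,
      Module.End.mul_apply, Finsupp.add_apply]
    have h00 : phaseLsite M β v j 0 0 (Finsupp.single n 1)
        = (v⁻¹ - β * v * (if n j = 0 then 1 else 0)) • Finsupp.single n 1 := by
      simp [phaseLsite]
    have h01 : phaseLsite M β v j 0 1 (Finsupp.single n 1)
        = Finsupp.single (Function.update n j (n j + 1)) 1 := by
      simp [phaseLsite]
    have h10 : phaseLsite M β v j 1 0 (Finsupp.single n 1)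
        = if n j = 0 then 0 else Finsupp.single (Function.update n j (n j - 1)) 1 := by
      by_cases h : n j = 0 <;> simp [phaseLsite, h]
    have h11 : phaseLsite M β v j 1 1 (Finsupp.single n 1) = v • Finsupp.single n 1 := by
      simp [phaseLsite]
    by_cases hall : ∀ i, i ∉ j :: l → n' i = n i
    · simp only [if_pos hall] at key key0 ⊢
      fin_cases b
      · simp only [Fin.zero_eta, h00, h10, map_smul, Finsupp.smul_apply, key0, smul_eq_mul]
        rcases Nat.eq_zero_or_pos (n j) with h | h
        · simp [h, phaseW, mul_comm]
        · have h' : (n' j = n j - 1) ↔ (n' j + 1 = n j) := by omega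
          simp [h.ne', key, h', phaseW, mul_comm]
      · simp only [Fin.mk_one, h01, h11, map_smul, Finsupp.smul_apply, key0, key, smul_eq_mul]
        simp [phaseW, mul_comm]
    · simp only [if_neg hall, ite_self] at key key0 ⊢
      fin_cases b
      · simp only [Fin.zero_eta, h00, h10, map_smul, Finsupp.smul_apply, key0, smul_zero, zero_add]
        split_ifs <;> simp [key]
      · simp only [Fin.mk_one, h01, h11, map_smul, Finsupp.smul_apply, key0, key, smul_zero,
          zero_add]

lemma phaseT_apply (M : ℕ) (β v : ℂ) (a b : Fin 2) (n' n : Fin M → ℕ) :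
    (phaseT M β v a b (Finsupp.single n 1)) n' =
      (List.ofFn fun j => phaseW β v (n' j) (n j)).reverse.prod a b := by
  have h := prod_phaseLsite_apply M β v n' (List.finRange M) (List.nodup_finRange M) a b n
  simpa only [phaseT, List.ofFn_eq_map, List.mem_finRange, not_true_eq_false, false_imp_iff,
    implies_true, if_true] using h

lemma reverse_ofFn {α : Type*} {n : ℕ} (f : Fin n → α) :
    (List.ofFn f).reverse = List.ofFn (f ∘ Fin.rev) := by
  apply List.ext_getElem (by simp)
  intro i h1 h2
  simp only [List.getElem_reverse, List.getElem_ofFn, List.length_ofFn, Function.comp_apply]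
  congr 1
  ext
  simp [Fin.rev]
  omega

/-- Transposing the Fock spaces and reversing the order of the sites exchanges `𝓒` and `𝓑`. -/
lemma phaseC_apply_eq_phaseB_apply (M : ℕ) (β v : ℂ) (n' n : Fin M → ℕ) :
    (phaseC M β v (Finsupp.single n 1)) n'
      = (phaseB M β v (Finsupp.single (n' ∘ Fin.rev) 1)) (n ∘ Fin.rev) := by
  rw [phaseC, phaseB, phaseT_apply, phaseT_apply, ← transpose_apply (List.prod _) 0 1,
    transpose_list_prod, List.map_reverse, List.reverse_reverse, List.map_ofFn]
  simp only [reverse_ofFn, Function.comp_def, Fin.rev_rev, phaseW_transpose]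

/-- The pairing of Fock spaces which reverses the order of the sites. -/
def revPairing (M : ℕ) : FockM M →ₗ[ℂ] FockM M →ₗ[ℂ] ℂ :=
  Finsupp.linearCombination ℂ fun n => Finsupp.lapply (n ∘ Fin.rev)

lemma revPairing_single_left (M : ℕ) (n : Fin M → ℕ) (f : FockM M) :
    revPairing M (Finsupp.single n 1) f = f (n ∘ Fin.rev) := by
  simp [revPairing]

lemma revPairing_single_right (M : ℕ) (n : Fin M → ℕ) (g : FockM M) :
    revPairing M g (Finsupp.single n 1) = g (n ∘ Fin.rev) := by
  have hrev : ∀ m : Fin M → ℕ, m ∘ Fin.rev = n ↔ m = n ∘ Fin.rev := by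
    intro m
    constructor <;> rintro rfl <;> ext <;> simp
  induction g using Finsupp.induction_linear with
  | zero => simp
  | add f g hf hg => simp [hf, hg]
  | single m c =>
    simp [revPairing, Finsupp.single_apply, ← hrev, eq_comm]

lemma revPairing_phaseC (M : ℕ) (β v : ℂ) (g f : FockM M) :
    revPairing M g (phaseC M β v f) = revPairing M (phaseB M β v g) f := by
  have h : (revPairing M).compl₂ (phaseC M β v) = (revPairing M).comp (phaseB M β v) := by
    ext n' n
    simp [revPairing_single_left, revPairing_single_right, phaseC_apply_eq_phaseB_apply,
      Function.comp_assoc, Fin.rev_involutive.comp_self]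
  exact LinearMap.congr_fun₂ h g f

lemma revPairing_prod_phaseC (M : ℕ) (β : ℂ) (l : List ℂ) (g f : FockM M) :
    revPairing M g ((l.map (phaseC M β)).prod f)
      = revPairing M ((l.reverse.map (phaseB M β)).prod g) f := by
  induction l generalizing g with
  | nil => simp
  | cons v l ih => simp [revPairing_phaseC, ih]

lemma phaseB_apply (M : ℕ) (β v : ℂ) (f : FockM M) (n' : Fin M → ℕ) :
    (phaseB M β v f) n' = ∑ n ∈ f.support, f n * (phaseB M β v (Finsupp.single n 1)) n' := by
  conv_lhs => rw [← Finsupp.sum_single f, Finsupp.sum, map_sum, Finsupp.finsetSum_apply]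
  refine sum_congr rfl fun n _ => ?_
  rw [← mul_one (f n), ← smul_eq_mul, ← Finsupp.smul_single, map_smul]
  simp

/-- The one-row partition functions on the first `M` sites. -/
def phaseX (β v : ℂ) (a b : ℕ → ℕ) : ℕ → Matrix (Fin 2) (Fin 2) ℂ
  | 0 => 1
  | m + 1 => phaseW β v (a m) (b m) * phaseX β v a b m

lemma phaseB_single_apply (M : ℕ) (β v : ℂ) (a b : ℕ → ℕ) :
    (phaseB M β v (Finsupp.single (fun j => b j) 1)) (fun j => a j) = phaseX β v a b M 0 1 := by
  rw [phaseB, phaseT_apply]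
  have h : ∀ M : ℕ, (List.ofFn fun j : Fin M => phaseW β v (a j) (b j)).reverse.prod
      = phaseX β v a b M := by
    intro M
    induction M with
    | zero => simp [phaseX]
    | succ M ih =>
      rw [List.ofFn_succ_last, List.reverse_append, List.prod_append, phaseX, ← ih]
      simp
  rw [h]

/-- Particle number conservation. -/
lemma phaseX_conservation (β v : ℂ) (a b : ℕ → ℕ) (m : ℕ) (i j : Fin 2)
    (h : phaseX β v a b m i j ≠ 0) :
    (∑ k ∈ range m, a k) + i = (∑ k ∈ range m, b k) + j := by
  induction m generalizing i with
  | zero =>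
    simp only [phaseX, Matrix.one_apply] at h
    simp; split_ifs at h <;> simp_all
  | succ m ih =>
    rw [phaseX, mul_apply] at h
    obtain ⟨c, -, hc⟩ := exists_ne_zero_of_sum_ne_zero h
    have h1 := ih c (right_ne_zero_of_mul hc)
    have h2 := left_ne_zero_of_mul hc
    rw [sum_range_succ, sum_range_succ]
    have h3 : a m + i = b m + c := by
      fin_cases i <;> fin_cases c <;> simp [phaseW] at h2 ⊢ <;> omega
    omega

lemma phaseX_exists_ne_zero (β v : ℂ) (a b : ℕ → ℕ) {M m : ℕ} (hm : m ≤ M) (i j : Fin 2)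
    (h : phaseX β v a b M i j ≠ 0) : ∃ c, phaseX β v a b m c j ≠ 0 := by
  induction M, hm using Nat.le_induction generalizing i with
  | base => exact ⟨i, h⟩
  | succ M _ ih =>
    rw [phaseX, mul_apply] at h
    obtain ⟨c, -, hc⟩ := exists_ne_zero_of_sum_ne_zero h
    exact ih c (right_ne_zero_of_mul hc)

/-- The number of parts of `f` equal to `i`. -/
def occ {N : ℕ} (f : Fin N → ℕ) (i : ℕ) : ℕ := #{k | f k = i}

/-- The number of parts of `f` smaller than `m`. -/
def partsBelow {N : ℕ} (f : Fin N → ℕ) (m : ℕ) : ℕ := #{k | f k < m}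

lemma partsBelow_succ {N : ℕ} (f : Fin N → ℕ) (m : ℕ) :
    partsBelow f (m + 1) = partsBelow f m + occ f m := by
  rw [partsBelow, partsBelow, occ, ← card_union_of_disjoint, ← filter_or]
  · congr 1; ext k; simp; omega
  · rw [disjoint_filter]; intro k _ h1 h2; omega

lemma sum_occ {N : ℕ} (f : Fin N → ℕ) (m : ℕ) : ∑ i ∈ range m, occ f i = partsBelow f m := by
  induction m with
  | zero => simp [partsBelow]
  | succ m ih => rw [sum_range_succ, ih, partsBelow_succ]

lemma partsBelow_of_forall_lt {N : ℕ} {f : Fin N → ℕ} {m : ℕ} (h : ∀ k, f k < m) :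
    partsBelow f m = N := by
  simp [partsBelow, h]

lemma lt_iff_le_partsBelow {N : ℕ} {f : Fin N → ℕ} (hf : Antitone f) (k : Fin N) (m : ℕ) :
    f k < m ↔ N ≤ partsBelow f m + k := by
  constructor
  · intro h
    have : Ici k ⊆ ({i | f i < m} : Finset (Fin N)) := fun i hi => by
      simpa using (hf (mem_Ici.1 hi)).trans_lt h
    have := card_le_card this
    rw [Fin.card_Ici] at this
    rw [partsBelow]; omega
  · intro h
    by_contra hk
    have : ({i | f i < m} : Finset (Fin N)) ⊆ Ioi k := fun i hi => by
      rw [mem_Ioi]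
      by_contra hik
      exact hk ((hf (not_lt.1 hik)).trans_lt (by simpa using hi))
    have := card_le_card this
    rw [Fin.card_Ioi] at this
    have := k.2
    rw [partsBelow] at h; omega

lemma eq_of_occ_eq {N M : ℕ} {f g : Fin N → ℕ} (hf : Antitone f) (hg : Antitone g)
    (hfM : ∀ k, f k < M) (hgM : ∀ k, g k < M) (h : ∀ i < M, occ f i = occ g i) : f = g := by
  have hb : ∀ m ≤ M, partsBelow f m = partsBelow g m := fun m hm => by
    rw [← sum_occ, ← sum_occ]
    exact sum_congr rfl fun i hi => h i ((mem_range.1 hi).trans_le hm)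
  have key : ∀ k, ∀ m ≤ M, f k < m ↔ g k < m := fun k m hm => by
    rw [lt_iff_le_partsBelow hf, lt_iff_le_partsBelow hg, hb m hm]
  ext k
  have h1 := (key k (f k + 1) (hfM k)).1 (by omega)
  have h2 := (key k (g k + 1) (hgM k)).2 (by omega)
  omega

lemma exists_antitone_occ {N M : ℕ} (n : Fin M → ℕ) (hn : ∑ i, n i = N) :
    ∃ f : Fin N → ℕ, Antitone f ∧ (∀ k, f k < M) ∧ n = fun i : Fin M => occ f i := by
  subst hn
  let g : Fin (∑ i, n i) → Fin M := fun k => (finSigmaFinEquiv.symm k).1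
  let e : Equiv.Perm (Fin (∑ i, n i)) := Fin.revPerm.trans (Tuple.sort g)
  refine ⟨fun k => g (e k), ?_, fun k => (g _).2, ?_⟩
  · intro k l hkl
    exact Tuple.monotone_sort g (Fin.rev_le_rev.2 hkl)
  · ext i
    have h1 : occ (fun k => (g (e k) : ℕ)) i = #{k | g k = i} := by
      refine card_bij (fun k _ => e k) (by simp [Fin.ext_iff]) (by simp) fun k hk => ?_
      exact ⟨e.symm k, by simpa [Fin.ext_iff] using hk, by simp⟩
    rw [h1]
    have h2 : #{k | g k = i} = #(univ : Finset (Fin (n i))) := by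
      symm
      refine card_bij (fun k _ => finSigmaFinEquiv ⟨i, k⟩) (by simp [g]) ?_ ?_
      · intro a _ b _ hab
        simpa using hab
      · intro k hk
        have hk : g k = i := by simpa using hk
        subst hk
        exact ⟨(finSigmaFinEquiv.symm k).2, mem_univ _, by simp [g]⟩
    simp [h2]

lemma mem_interlacing_of_partsBelow {N M : ℕ} {lam : Fin (N + 1) → ℕ} {mu : Fin N → ℕ}
    (hlam : Antitone lam) (hmu : Antitone mu) (hlamM : ∀ k, lam k < M) (hmuM : ∀ k, mu k < M)
    (h : ∀ m ≤ M, partsBelow mu m ≤ partsBelow lam m ∧ partsBelow lam m ≤ partsBelow mu m + 1) :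
    mu ∈ interlacing lam := by
  rw [interlacing, Fintype.mem_piFinset]
  intro k
  rw [mem_Icc]
  constructor
  · refine Nat.lt_succ_iff.1 ((lt_iff_le_partsBelow hlam _ _).2 ?_)
    have h1 := (lt_iff_le_partsBelow hmu k (mu k + 1)).1 (by omega)
    have h2 := h (mu k + 1) (hmuM k)
    simp; omega
  · refine Nat.lt_succ_iff.1 ((lt_iff_le_partsBelow hmu _ _).2 ?_)
    have h1 := (lt_iff_le_partsBelow hlam k.castSucc (lam k.castSucc + 1)).1 (by omega)
    have h2 := h (lam k.castSucc + 1) (hlamM _)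
    rw [Fin.val_castSucc] at h1
    rw [Nat.succ_eq_add_one]; omega

lemma antitone_of_mem_interlacing {N : ℕ} {lam : Fin (N + 1) → ℕ} {mu : Fin N → ℕ}
    (hlam : Antitone lam) (h : mu ∈ interlacing lam) : Antitone mu := by
  rw [interlacing, Fintype.mem_piFinset] at h
  intro k l hkl
  rcases hkl.eq_or_lt with rfl | hlt
  · rfl
  · exact (mem_Icc.1 (h l)).2.trans ((hlam (Fin.succ_le_castSucc_iff.2 hlt)).trans
      (mem_Icc.1 (h k)).1)

lemma partsBelow_of_mem_interlacing {N : ℕ} {lam : Fin (N + 1) → ℕ} {mu : Fin N → ℕ}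
    (hlam : Antitone lam) (h : mu ∈ interlacing lam) (m : ℕ) :
    partsBelow mu m ≤ partsBelow lam m ∧ partsBelow lam m ≤ partsBelow mu m + 1 := by
  have hmu := antitone_of_mem_interlacing hlam h
  rw [interlacing, Fintype.mem_piFinset] at h
  have hN : partsBelow mu m ≤ N := (card_le_univ _).trans (by simp)
  have hN' : partsBelow lam m ≤ N + 1 := (card_le_univ _).trans (by simp)
  constructor
  · rcases Nat.eq_zero_or_pos (partsBelow mu m) with h0 | h0
    · omega
    · have hk := (lt_iff_le_partsBelow hmu ⟨N - partsBelow mu m, by omega⟩ m).2 (by simp; omega)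
      have := (lt_iff_le_partsBelow hlam _ m).1 ((mem_Icc.1 (h _)).1.trans_lt hk)
      simp at this; omega
  · rcases Nat.lt_or_ge (partsBelow lam m) 2 with h0 | h0
    · omega
    · have hk := (lt_iff_le_partsBelow hlam
        (Fin.castSucc ⟨N + 1 - partsBelow lam m, by omega⟩) m).2 (by simp; omega)
      have := (lt_iff_le_partsBelow hmu _ m).1 ((mem_Icc.1 (h _)).2.trans_lt hk)
      simp at this; omega

lemma sum_partsBelow {N M : ℕ} {f : Fin N → ℕ} (h : ∀ k, f k < M) :
    ∑ m ∈ range M, partsBelow f m + ∑ k, f k + N = N * M := by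
  have h1 : ∑ m ∈ range M, partsBelow f m = ∑ k, (M - 1 - f k) := by
    simp only [partsBelow, card_filter]
    rw [sum_comm]
    refine sum_congr rfl fun k _ => ?_
    rw [← card_filter, show (range M).filter (fun m => f k < m) = Ioo (f k) M by
      ext; simp; omega, Nat.card_Ioo]
    omega
  have h2 : ∑ k, (M - 1 - f k) + ∑ k, f k + ∑ _k : Fin N, 1 = ∑ _k : Fin N, M := by
    rw [← sum_add_distrib, ← sum_add_distrib]
    exact sum_congr rfl fun k _ => by have := h k; omega
  simpa [h1] using h2

/-- The sites at which an empty line meets a particle correspond to the strict inequalities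
in the interlacing condition. -/
lemma card_empty_occupied {N M : ℕ} {lam : Fin (N + 1) → ℕ} {mu : Fin N → ℕ}
    (hlam : Antitone lam) (hmuM : ∀ k, mu k < M) (h : mu ∈ interlacing lam) :
    #{i ∈ range M | partsBelow lam i ≠ partsBelow mu i ∧ occ mu i ≠ 0}
      = #{k | lam k.succ < mu k} := by
  have hmu := antitone_of_mem_interlacing hlam h
  have hb := partsBelow_of_mem_interlacing hlam h
  have key : ∀ k, lam k.succ < mu k → partsBelow mu (mu k) + k + 1 = N ∧
      partsBelow lam (mu k) + k = N := fun k hk => by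
    have h1 := (lt_iff_le_partsBelow hlam k.succ (mu k)).1 hk
    have h2 := (lt_iff_le_partsBelow hmu k (mu k)).not.1 (by omega)
    have := hb (mu k)
    simp at h1; omega
  symm
  refine card_bij (fun k _ => mu k) ?_ ?_ ?_
  · intro k hk
    have hk : lam k.succ < mu k := by simpa using hk
    have := key k hk
    refine mem_filter.2 ⟨mem_range.2 (hmuM k), by omega, ?_⟩
    exact card_ne_zero.2 ⟨k, by simp⟩
  · intro k hk l hl hkl
    have h1 := key k (by simpa using hk)
    have h2 := key l (by simpa using hl)
    rw [hkl] at h1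
    ext; omega
  · intro i hi
    obtain ⟨-, hi1, hi2⟩ := mem_filter.1 hi
    have h1 := hb i
    have h2 := partsBelow_succ mu i
    have hN : partsBelow mu (i + 1) ≤ N := (card_le_univ _).trans (by simp)
    let k : Fin N := ⟨N - 1 - partsBelow mu i, by omega⟩
    have hk1 := (lt_iff_le_partsBelow hmu k (i + 1)).2 (by simp [k]; omega)
    have hk2 := (lt_iff_le_partsBelow hmu k i).not.2 (by simp [k]; omega)
    have hk3 := (lt_iff_le_partsBelow hlam k.succ i).2 (by simp [k]; omega)
    have hk : mu k = i := by omega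
    exact ⟨k, by simpa [hk] using hk3, hk⟩

/-- The state of the auxiliary line before site `m`. -/
def lineState {N : ℕ} (lam : Fin (N + 1) → ℕ) (mu : Fin N → ℕ) (m : ℕ) : Fin 2 :=
  if partsBelow lam m = partsBelow mu m then 1 else 0

lemma phaseX_succ_lineState {N : ℕ} (β v : ℂ) (lam : Fin (N + 1) → ℕ) (mu : Fin N → ℕ)
    (m : ℕ) (i : Fin 2) :
    phaseX β v (occ lam) (occ mu) (m + 1) i 1
      = phaseW β v (occ lam m) (occ mu m) i (lineState lam mu m)
        * phaseX β v (occ lam) (occ mu) m (lineState lam mu m) 1 := by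
  rw [phaseX, mul_apply]
  refine sum_eq_single _ (fun c _ hc => ?_) (by simp)
  by_contra hne
  apply hc
  have h1 := phaseX_conservation β v _ _ m c 1 (right_ne_zero_of_mul hne)
  rw [sum_occ, sum_occ] at h1
  rw [lineState]
  fin_cases c <;> simp at h1 ⊢ <;> omega

lemma phaseX_lineState {N : ℕ} {β v p z : ℂ} (hv : v ≠ 0) (hp : p + β * v = v⁻¹)
    (hz : p * z = v) {lam : Fin (N + 1) → ℕ} {mu : Fin N → ℕ}
    (hlam : Antitone lam) (h : mu ∈ interlacing lam) (m : ℕ) :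
    phaseX β v (occ lam) (occ mu) m (lineState lam mu m) 1
        * (if partsBelow lam m = partsBelow mu m then 1 else v)
      = ∏ i ∈ range m, (p * (if partsBelow lam i = partsBelow mu i then z else 1) *
          (if partsBelow lam i ≠ partsBelow mu i ∧ occ mu i ≠ 0 then 1 + β * z else 1)) := by
  induction m with
  | zero =>
    have h0 : partsBelow lam 0 = partsBelow mu 0 := by simp [partsBelow]
    have hs : lineState lam mu 0 = 1 := if_pos h0
    rw [hs, phaseX, Matrix.one_apply_eq]
    simp [h0]
  | succ m ih =>
    rw [prod_range_succ, ← ih, phaseX_succ_lineState]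
    have hpz : p * (1 + β * z) = v⁻¹ := by linear_combination hp + β * hz
    have hpv : p * (1 + β * z) * v = 1 := by rw [hpz, inv_mul_cancel₀ hv]
    have hb := partsBelow_of_mem_interlacing hlam h m
    have hb' := partsBelow_of_mem_interlacing hlam h (m + 1)
    have hl := partsBelow_succ lam m
    have hm := partsBelow_succ mu m
    have key : phaseW β v (occ lam m) (occ mu m) (lineState lam mu (m + 1)) (lineState lam mu m)
          * (if partsBelow lam (m + 1) = partsBelow mu (m + 1) then 1 else v)
        = (if partsBelow lam m = partsBelow mu m then 1 else v) *
          (p * (if partsBelow lam m = partsBelow mu m then z else 1) *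
          (if partsBelow lam m ≠ partsBelow mu m ∧ occ mu m ≠ 0 then 1 + β * z else 1)) := by
      unfold lineState
      by_cases h1 : partsBelow lam m = partsBelow mu m <;>
        by_cases h2 : partsBelow lam (m + 1) = partsBelow mu (m + 1)
      · have : occ lam m = occ mu m := by omega
        simp [h1, h2, phaseW, this, hz]
      · have : occ lam m = occ mu m + 1 := by omega
        simp [h1, h2, phaseW, this, hz]
      · have h3 : occ lam m + 1 = occ mu m := by omega
        have h4 : occ mu m ≠ 0 := by omega
        simp only [h1, h2, phaseW, h3]
        simp [h1, h4, mul_comm v, hpv]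
      · have h3 : occ lam m = occ mu m := by omega
        by_cases h4 : occ mu m = 0
        · simp only [h1, h2, phaseW, h3, h4]
          simp
          linear_combination -v * hp
        · simp [h1, h2, phaseW, h3, h4, hpz, mul_comm]
    linear_combination phaseX β v (occ lam) (occ mu) m (lineState lam mu m) 1 * key

/-- The matrix elements of `𝓑` are the branching coefficients of Grothendieck polynomials. -/
lemma phaseX_eq_grothBranchWeight {N M : ℕ} {β v p z : ℂ} (hv : v ≠ 0) (hp : p + β * v = v⁻¹)
    (hz : p * z = v) (hM : 1 ≤ M) {lam : Fin (N + 1) → ℕ} {mu : Fin N → ℕ}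
    (hlam : Antitone lam) (hlamM : ∀ k, lam k < M) (h : mu ∈ interlacing lam) :
    phaseX β v (occ lam) (occ mu) M 0 1 = p ^ (M - 1) * grothBranchWeight β z lam mu := by
  have hI : ∀ k, lam k.succ ≤ mu k ∧ mu k ≤ lam k.castSucc := fun k =>
    mem_Icc.1 (Fintype.mem_piFinset.1 h k)
  have hmuM : ∀ k, mu k < M := fun k => (hI k).2.trans_lt (hlamM _)
  have hX := phaseX_lineState hv hp hz hlam h M
  have hne : partsBelow lam M ≠ partsBelow mu M := by
    rw [partsBelow_of_forall_lt hlamM, partsBelow_of_forall_lt hmuM]; omega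
  rw [lineState, if_neg hne, if_neg hne, prod_mul_distrib, prod_mul_distrib, prod_const,
    prod_ite, prod_ite, card_range, prod_const, prod_const_one, prod_const, prod_const_one,
    card_empty_occupied hlam hmuM h, mul_one, mul_one] at hX
  have hW : grothBranchWeight β z lam mu
      = z ^ (lam (Fin.last N) + ∑ k, (lam k.castSucc - mu k))
        * (1 + β * z) ^ #{k | lam k.succ < mu k} := by
    rw [grothBranchWeight, prod_mul_distrib, prod_pow_eq_pow_sum, prod_ite, prod_const,
      prod_const_one, mul_one, pow_add, mul_assoc]
  have hD : lam (Fin.last N) + ∑ k, (lam k.castSucc - mu k) + ∑ k, mu k = ∑ k, lam k := by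
    rw [Fin.sum_univ_castSucc, add_assoc, ← sum_add_distrib, add_comm]
    congr 1
    exact sum_congr rfl fun k _ => Nat.sub_add_cancel (hI k).2
  have hC : #{i ∈ range M | partsBelow lam i = partsBelow mu i} + ∑ i ∈ range M, partsBelow lam i
      = M + ∑ i ∈ range M, partsBelow mu i := by
    have : ∑ i ∈ range M, ((if partsBelow lam i = partsBelow mu i then 1 else 0)
        + partsBelow lam i) = ∑ i ∈ range M, (1 + partsBelow mu i) :=
      sum_congr rfl fun i _ => by
        have := partsBelow_of_mem_interlacing hlam h i
        split_ifs <;> omega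
    rwa [sum_add_distrib, sum_add_distrib, sum_const, card_range, smul_eq_mul, mul_one,
      ← card_filter] at this
  have hL := sum_partsBelow hlamM
  have hU := sum_partsBelow hmuM
  rw [Nat.succ_mul] at hL
  have hcard : #{i ∈ range M | partsBelow lam i = partsBelow mu i}
      = lam (Fin.last N) + ∑ k, (lam k.castSucc - mu k) + 1 := by omega
  apply mul_right_cancel₀ hv
  obtain ⟨M, rfl⟩ : ∃ m, M = m + 1 := ⟨M - 1, by omega⟩
  rw [hX, hcard, hW, Nat.add_sub_cancel, pow_succ, pow_succ, ← hz]
  ring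

/-- The states `𝓑(v₁)⋯𝓑(v_N)|Ω⟩` have particle number `N`. -/
lemma sum_eq_of_prod_phaseB_ne_zero (M : ℕ) (β : ℂ) (l : List ℂ) (n : Fin M → ℕ)
    (h : ((l.map (phaseB M β)).prod (Finsupp.single (fun _ => 0) 1)) n ≠ 0) :
    ∑ i, n i = l.length := by
  have hext : ∀ n : Fin M → ℕ, ∃ a : ℕ → ℕ, n = fun i : Fin M => a i := fun n =>
    ⟨fun i => if hi : i < M then n ⟨i, hi⟩ else 0, by ext; simp⟩
  induction l generalizing n with
  | nil =>
    have h : (fun _ => 0) = n := by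
      by_contra hne
      simp [hne] at h
    simp [← h]
  | cons v l ih =>
    rw [List.map_cons, List.prod_cons, Module.End.mul_apply, phaseB_apply] at h
    obtain ⟨m, hm, hne⟩ := exists_ne_zero_of_sum_ne_zero h
    have h1 := ih m (left_ne_zero_of_mul hne)
    have h2 := right_ne_zero_of_mul hne
    obtain ⟨a, rfl⟩ := hext n
    obtain ⟨b, rfl⟩ := hext m
    rw [phaseB_single_apply] at h2
    have h3 := phaseX_conservation β v a b M 0 1 h2
    rw [Fin.sum_univ_eq_sum_range] at h1 ⊢
    simp at h3 ⊢
    omega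

lemma phaseB_wavefunction (β : ℂ) {M : ℕ} (hM : 1 ≤ M) (N : ℕ) (v : Fin N → ℂ)
    (hv0 : ∀ j, v j ≠ 0) (hvsq : ∀ j k, j ≠ k → (v j) ^ 2 ≠ (v k) ^ 2)
    (hvβ : ∀ j, ((v j)⁻¹) ^ 2 ≠ β) (lam : Fin N → ℕ) (hlam : Antitone lam)
    (hlamM : ∀ k, lam k < M) :
    (((List.ofFn fun j : Fin N => phaseB M β (v j)).prod)
        (Finsupp.single (fun _ => 0) 1)) (fun i => occ lam i)
      = (∏ j, ((v j)⁻¹ - β * v j) ^ (M - 1))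
        * Groth N β lam (fun j => (((v j)⁻¹) ^ 2 - β)⁻¹) := by
  induction N with
  | zero => simp [Groth, occ]
  | succ N ih =>
    set f : FockM M := (List.ofFn fun j : Fin N => phaseB M β (v j.succ)).prod
        (Finsupp.single (fun _ => 0) 1) with hf
    have hfl : f = ((List.ofFn fun j : Fin N => v j.succ).map (phaseB M β)).prod
        (Finsupp.single (fun _ => 0) 1) := by
      rw [hf, List.map_ofFn]; rfl
    rw [List.ofFn_succ, List.prod_cons, Module.End.mul_apply, ← hf, phaseB_apply]
    have hsub : ((v 0)⁻¹) ^ 2 - β ≠ 0 := sub_ne_zero.2 (hvβ 0)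
    have hp : ((v 0)⁻¹ - β * v 0) + β * v 0 = (v 0)⁻¹ := by ring
    have hpe : (v 0)⁻¹ - β * v 0 = v 0 * (((v 0)⁻¹) ^ 2 - β) := by
      have := hv0 0
      field_simp
    have hz : ((v 0)⁻¹ - β * v 0) * (((v 0)⁻¹) ^ 2 - β)⁻¹ = v 0 := by
      rw [hpe, mul_assoc, mul_inv_cancel₀ hsub, mul_one]
    have hz1 : 1 + β * (((v 0)⁻¹) ^ 2 - β)⁻¹ ≠ 0 := by
      have : 1 + β * (((v 0)⁻¹) ^ 2 - β)⁻¹ = ((v 0)⁻¹) ^ 2 * (((v 0)⁻¹) ^ 2 - β)⁻¹ := by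
        rw [← sub_eq_zero]
        have := mul_inv_cancel₀ hsub
        linear_combination -this
      rw [this]
      exact mul_ne_zero (pow_ne_zero _ (inv_ne_zero (hv0 0))) (inv_ne_zero hsub)
    have hinj : Function.Injective fun j => (((v j)⁻¹) ^ 2 - β)⁻¹ := by
      intro j k hjk
      by_contra hne
      apply hvsq j k hne
      have := sub_left_injective (inv_injective hjk)
      simpa using this
    have hB : ∀ mu : Fin N → ℕ, (phaseB M β (v 0) (Finsupp.single (fun i => occ mu i) 1))
        (fun i => occ lam i) = phaseX β (v 0) (occ lam) (occ mu) M 0 1 := fun mu =>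
      phaseB_single_apply M β (v 0) (occ lam) (occ mu)
    have hmuM : ∀ mu ∈ interlacing lam, ∀ k, mu k < M := fun mu hmu k =>
      (mem_Icc.1 (Fintype.mem_piFinset.1 hmu k)).2.trans_lt (hlamM _)
    have hocc : ∀ mu ∈ interlacing lam, ∀ k ∈ interlacing lam,
        (fun i : Fin M => occ mu i) = (fun i : Fin M => occ k i) → mu = k :=
      fun mu hmu nu hnu he => eq_of_occ_eq (antitone_of_mem_interlacing hlam hmu)
        (antitone_of_mem_interlacing hlam hnu) (hmuM mu hmu) (hmuM nu hnu)
        fun i hi => congrFun he ⟨i, hi⟩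
    have hreindex : ∑ n ∈ f.support,
          f n * (phaseB M β (v 0) (Finsupp.single n 1)) (fun i => occ lam i)
        = ∑ mu ∈ interlacing lam, f (fun i => occ mu i) *
          phaseX β (v 0) (occ lam) (occ mu) M 0 1 := by
      rw [sum_subset (subset_union_left (s₂ := (interlacing lam).image
        fun mu => fun i : Fin M => occ mu i))
        (fun n _ hn => by rw [Finsupp.notMem_support_iff.1 hn, zero_mul])]
      symm
      refine sum_of_injOn (fun mu => fun i : Fin M => occ mu i)
        (fun mu hmu nu hnu => hocc mu hmu nu hnu)
        (fun mu hmu => by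
          simp only [coe_union, coe_image]
          exact Or.inr ⟨mu, hmu, rfl⟩) ?_ (fun mu _ => by rw [hB])
      intro n _ hn
      by_contra hne
      apply hn
      have h1 := left_ne_zero_of_mul hne
      have h2 := right_ne_zero_of_mul hne
      rw [hfl] at h1
      have hsum := sum_eq_of_prod_phaseB_ne_zero M β _ n h1
      rw [List.length_ofFn] at hsum
      obtain ⟨mu, hmu, hmuM', rfl⟩ := exists_antitone_occ n hsum
      rw [hB] at h2
      refine ⟨mu, mem_interlacing_of_partsBelow hlam hmu hlamM hmuM' fun m hm => ?_, rfl⟩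
      obtain ⟨c, hc⟩ := phaseX_exists_ne_zero _ _ _ _ hm _ _ h2
      have h3 := phaseX_conservation _ _ _ _ m c 1 hc
      rw [sum_occ, sum_occ] at h3
      have := c.2
      simp at h3
      omega
    rw [hreindex, Groth_branching β lam hlam _ hz1 hinj, Fin.prod_univ_succ, mul_sum]
    refine sum_congr rfl fun mu hmu => ?_
    rw [phaseX_eq_grothBranchWeight (hv0 0) hp hz hM hlam hlamM hmu,
      ih (fun j => v j.succ) (fun j => hv0 _)
        (fun j k hjk => hvsq _ _ ((Fin.succ_injective N).ne hjk)) (fun j => hvβ _) mu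
        (antitone_of_mem_interlacing hlam hmu) (hmuM mu hmu)]
    ring

lemma forall_lt_of_sum_card {N M : ℕ} {nocc : Fin M → ℕ} (hsum : ∑ i, nocc i = N)
    {lam : Fin N → ℕ} (hcard : ∀ i : Fin M, occ lam i = nocc i) (k : Fin N) : lam k < M := by
  have h1 : partsBelow lam M = N := by
    rw [← sum_occ, ← Fin.sum_univ_eq_sum_range]
    exact (sum_congr rfl fun i _ => hcard i).trans hsum
  have h2 : ({k | lam k < M} : Finset (Fin N)) = univ :=
    eq_univ_of_card _ (by simpa [partsBelow] using h1)
  exact (mem_filter.1 (h2.symm ▸ mem_univ k : k ∈ ({k | lam k < M} : Finset (Fin N)))).2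

lemma occ_complement {N M : ℕ} {lam : Fin N → ℕ} (hlamM : ∀ k, lam k < M) (i : Fin M) :
    occ (fun j => M - 1 - lam (Fin.rev j)) i = occ lam (Fin.rev i) := by
  refine card_bij (fun k _ => Fin.rev k) ?_ (by simp) ?_
  · intro k hk
    have hk : M - 1 - lam (Fin.rev k) = i := by simpa using hk
    have := hlamM (Fin.rev k)
    simp [Fin.val_rev]; omega
  · intro k hk
    have hk : lam k = Fin.rev i := by simpa using hk
    refine ⟨Fin.rev k, ?_, by simp⟩
    have := i.2
    rw [Fin.val_rev] at hk
    simp [hk]; omega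

lemma phaseC_wavefunction (β : ℂ) {M : ℕ} (hM : 1 ≤ M) (N : ℕ) (v : Fin N → ℂ)
    (hv0 : ∀ j, v j ≠ 0) (hvsq : ∀ j k, j ≠ k → (v j) ^ 2 ≠ (v k) ^ 2)
    (hvβ : ∀ j, ((v j)⁻¹) ^ 2 ≠ β) (lam : Fin N → ℕ) (hlam : Antitone lam)
    (hlamM : ∀ k, lam k < M) :
    (((List.ofFn fun j : Fin N => phaseC M β (v j)).prod)
        (Finsupp.single (fun i => occ lam i) 1)) (fun _ => 0)
      = (∏ j, ((v j)⁻¹ - β * v j) ^ (M - 1))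
        * Groth N β (fun j => M - 1 - lam (Fin.rev j)) (fun j => (((v j)⁻¹) ^ 2 - β)⁻¹) := by
  have hpair := revPairing_prod_phaseC M β (List.ofFn v) (Finsupp.single (fun _ => 0) 1)
    (Finsupp.single (fun i : Fin M => occ lam i) 1)
  rw [revPairing_single_left, revPairing_single_right, reverse_ofFn, List.map_ofFn,
    List.map_ofFn] at hpair
  have hB := phaseB_wavefunction β hM N (v ∘ Fin.rev) (fun j => hv0 _)
    (fun j k hjk => hvsq _ _ (Fin.rev_injective.ne hjk)) (fun j => hvβ _)
    (fun j => M - 1 - lam (Fin.rev j))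
    (fun j k hjk => Nat.sub_le_sub_left (hlam (Fin.rev_le_rev.2 hjk)) _)
    (fun k => by omega)
  simp only [occ_complement hlamM] at hB
  have hG := Groth_comp_perm N β (fun j => M - 1 - lam (Fin.rev j))
    (fun j => (((v j)⁻¹) ^ 2 - β)⁻¹) Fin.revPerm
  have hprod : ∏ j, (((v ∘ Fin.rev) j)⁻¹ - β * (v ∘ Fin.rev) j) ^ (M - 1)
      = ∏ j, ((v j)⁻¹ - β * v j) ^ (M - 1) :=
    Equiv.prod_comp Fin.revPerm fun j => ((v j)⁻¹ - β * v j) ^ (M - 1)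
  rw [hprod] at hB
  rw [← hG]
  exact hpair.trans hB

end GrothendieckWavefunctions

/-- The wavefunctions of the nonhermitian phase model are given by
Grothendieck polynomials.  The partition `λ = ((M−1)^{n_{M−1}},…,1^{n₁},0^{n₀})`
corresponding to the occupation numbers `{n}` is encoded by the hypotheses `hlam`, `hcard`;
`z_j⁻¹ = v_j⁻² − β` and `λ∨_j = M − 1 − λ_{N+1−j}`. -/
theorem phase_model_wavefunctions_grothendieck (β : ℂ) (M N : ℕ) (hM : 1 ≤ M) (hN : 1 ≤ N)
    (v : Fin N → ℂ) (hv0 : ∀ j, v j ≠ 0)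
    (hvsq : ∀ j k, j ≠ k → (v j) ^ 2 ≠ (v k) ^ 2)
    (hvβ : ∀ j, ((v j)⁻¹) ^ 2 ≠ β)
    (nocc : Fin M → ℕ) (hsum : ∑ i, nocc i = N)
    (lam : Fin N → ℕ) (hlam : Antitone lam)
    (hcard : ∀ i : Fin M,
      (Finset.univ.filter (fun j : Fin N => lam j = (i : ℕ))).card = nocc i) :
    (((List.ofFn fun j : Fin N => phaseB M β (v j)).prod)
        (Finsupp.single (fun _ => 0) 1)) nocc
      = (∏ j, ((v j)⁻¹ - β * v j) ^ (M - 1))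
        * Groth N β lam (fun j => (((v j)⁻¹) ^ 2 - β)⁻¹)
    ∧
    (((List.ofFn fun j : Fin N => phaseC M β (v j)).prod)
        (Finsupp.single nocc 1)) (fun _ => 0)
      = (∏ j, ((v j)⁻¹ - β * v j) ^ (M - 1))
        * Groth N β (fun j => M - 1 - lam (Fin.rev j)) (fun j => (((v j)⁻¹) ^ 2 - β)⁻¹) := by
  have hlamM := forall_lt_of_sum_card hsum hcard
  obtain rfl : nocc = fun i : Fin M => occ lam i := funext fun i => (hcard i).symm
  exact ⟨phaseB_wavefunction β hM N v hv0 hvsq hvβ lam hlam hlamM,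
    phaseC_wavefunction β hM N v hv0 hvsq hvβ lam hlam hlamM⟩
end
end

section
/- Let t ∈ ℂ, let α₁,…,α_M, γ₁,…,γ_M ∈ ℂ, let M ≥ N ≥ 1, and let z₁,…,z_N be pairwise distinct complex numbers. Then for any 1 ≤ x₁ < ⋯ < x_N ≤ M the wavefunction of the generalized Felderhof model satisfies ⟨x₁⋯x_N|Φ({z}_N, t, {α}, {γ})⟩ = ∏_{1≤j<k≤N} (z_j + t z_k) · s_λ(z | {α} | {γ}), where λ_j = x_{N−j+1} − N + j − 1. -/
noncomputable section

/-- The pair `(a,b)` of qubit indices as an index in `Fin 4` (basis order `|00⟩,|01⟩,|10⟩,|11⟩`). -/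
def pidx (p : Fin 2 × Fin 2) : Fin 4 :=
  ⟨2 * p.1.val + p.2.val, by have := p.1.isLt; have := p.2.isLt; omega⟩

/-- Reindex a `4 × 4` matrix as a matrix on `ℂ² ⊗ ℂ²` (auxiliary factor first). -/
def toPair (A : Matrix (Fin 4) (Fin 4) ℂ) : Matrix (Fin 2 × Fin 2) (Fin 2 × Fin 2) ℂ :=
  Matrix.of fun p q => A (pidx p) (pidx q)

/-- `L_{aj}`: a (possibly site-dependent) two-site operator acting on the auxiliary space
and the `j`-th site of the quantum space `V^{⊗M}`, identity elsewhere. -/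
def siteOp (M : ℕ) (Lm : Fin M → Matrix (Fin 2 × Fin 2) (Fin 2 × Fin 2) ℂ) (j : Fin M) :
    Matrix (Fin 2 × (Fin M → Fin 2)) (Fin 2 × (Fin M → Fin 2)) ℂ :=
  Matrix.of fun s t =>
    Lm j (s.1, s.2 j) (t.1, t.2 j) * (if ∀ i, i ≠ j → s.2 i = t.2 i then 1 else 0)

/-- The monodromy matrix `T_a = L_{aM} ⋯ L_{a1}`. -/
def monodromy (M : ℕ) (Lm : Fin M → Matrix (Fin 2 × Fin 2) (Fin 2 × Fin 2) ℂ) :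
    Matrix (Fin 2 × (Fin M → Fin 2)) (Fin 2 × (Fin M → Fin 2)) ℂ :=
  ((List.ofFn fun j : Fin M => siteOp M Lm j).reverse).prod

/-- The operator `B` on `V^{⊗M}`: the upper-right block `⟨0|_a T_a |1⟩_a` of the monodromy. -/
def Bop (M : ℕ) (Lm : Fin M → Matrix (Fin 2 × Fin 2) (Fin 2 × Fin 2) ℂ) :
    Matrix (Fin M → Fin 2) (Fin M → Fin 2) ℂ :=
  Matrix.of fun s t => monodromy M Lm (0, s) (1, t)

/-- The configuration of `V^{⊗M}` with particles (`|1⟩`) at the positions `x` and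
`|0⟩` elsewhere. -/
def conf {M N : ℕ} (x : Fin N → Fin M) : Fin M → Fin 2 :=
  fun i => if ∃ j, x j = i then 1 else 0

/-- The generalized Felderhof L-operator with site parameters `α`, `γ`. -/
def LgenFel (z t a g : ℂ) : Matrix (Fin 2 × Fin 2) (Fin 2 × Fin 2) ℂ :=
  toPair !![1 - g * z, 0, 0, 0;
            0, t + g * z, 1, 0;
            0, (t + 1) * z, a + (1 - a * g) * z, 0;
            0, 0, 0, -t * a + (1 - a * g) * z]

/-- The generalized factorial Schur function
`s_λ(z|{α}|{γ}) = det( f_{λ_k+N−k}(z_j) ) / ∏_{j<k}(z_j − z_k)` with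
`f_μ(z) = ∏_{i=1}^{μ}(α_i + (1−α_iγ_i)z) ∏_{i=μ+2}^{M}(1 − γ_iz)`
(the parameters `α, γ` are `1`-indexed sequences). -/
def genFactSchur (Mtop N : ℕ) (alpha gamma : ℕ → ℂ) (lam : Fin N → ℕ) (z : Fin N → ℂ) : ℂ :=
  Matrix.det (Matrix.of fun j k : Fin N =>
      (∏ i ∈ Finset.Icc 1 (lam k + (N - 1 - (k : ℕ))),
        (alpha i + (1 - alpha i * gamma i) * z j))
      * ∏ i ∈ Finset.Icc (lam k + (N - 1 - (k : ℕ)) + 2) Mtop, (1 - gamma i * z j))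
    / ∏ j : Fin N, ∏ k : Fin N, if j < k then z j - z k else 1


section BlockMatrices

/-- Assemble a `2 × 2` block of operators on the first `M` sites into an operator on `M + 1`
sites, the block indices being the states of the last site. -/
def lastSiteBlock {M : ℕ}
    (X : Matrix (Fin 2) (Fin 2) (Matrix (Fin M → Fin 2) (Fin M → Fin 2) ℂ)) :
    Matrix (Fin (M + 1) → Fin 2) (Fin (M + 1) → Fin 2) ℂ :=
  Matrix.of fun s t => X (s (Fin.last M)) (t (Fin.last M)) (Fin.init s) (Fin.init t)

lemma sum_config_succ {M : ℕ} (F : (Fin (M + 1) → Fin 2) → ℂ) :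
    ∑ s, F s = ∑ c : Fin 2, ∑ u : Fin M → Fin 2, F (Fin.snoc u c) := by
  rw [← Fintype.sum_prod_type']
  exact ((Fin.snocEquiv fun _ : Fin (M + 1) => Fin 2).sum_comp F).symm

lemma config_eq_iff {M : ℕ} {s t : Fin (M + 1) → Fin 2} :
    s = t ↔ s (Fin.last M) = t (Fin.last M) ∧ Fin.init s = Fin.init t := by
  constructor
  · rintro rfl
    exact ⟨rfl, rfl⟩
  · rintro ⟨h1, h2⟩
    rw [← Fin.snoc_init_self s, ← Fin.snoc_init_self t, h1, h2]

lemma lastSiteBlock_mul {M : ℕ}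
    (X Y : Matrix (Fin 2) (Fin 2) (Matrix (Fin M → Fin 2) (Fin M → Fin 2) ℂ)) :
    lastSiteBlock X * lastSiteBlock Y = lastSiteBlock (X * Y) := by
  ext s t
  simp [lastSiteBlock, Matrix.mul_apply, sum_config_succ, Matrix.sum_apply]

lemma smul_lastSiteBlock {M : ℕ} (c : ℂ)
    (X : Matrix (Fin 2) (Fin 2) (Matrix (Fin M → Fin 2) (Fin M → Fin 2) ℂ)) :
    c • lastSiteBlock X = lastSiteBlock (c • X) := by
  ext s t
  simp [lastSiteBlock]

lemma lastSiteBlock_add {M : ℕ}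
    (X Y : Matrix (Fin 2) (Fin 2) (Matrix (Fin M → Fin 2) (Fin M → Fin 2) ℂ)) :
    lastSiteBlock X + lastSiteBlock Y = lastSiteBlock (X + Y) := by
  ext s t
  simp [lastSiteBlock]

end BlockMatrices

section Monodromy

/-- Extend an operator on the auxiliary space and `M` sites by the identity on one more site. -/
def extendLast {M : ℕ}
    (X : Matrix (Fin 2 × (Fin M → Fin 2)) (Fin 2 × (Fin M → Fin 2)) ℂ) :
    Matrix (Fin 2 × (Fin (M + 1) → Fin 2)) (Fin 2 × (Fin (M + 1) → Fin 2)) ℂ :=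
  Matrix.of fun p q => if p.2 (Fin.last M) = q.2 (Fin.last M) then
    X (p.1, Fin.init p.2) (q.1, Fin.init q.2) else 0

lemma extendLast_one {M : ℕ} :
    extendLast (1 : Matrix (Fin 2 × (Fin M → Fin 2)) (Fin 2 × (Fin M → Fin 2)) ℂ) = 1 := by
  ext ⟨a, s⟩ ⟨b, t⟩
  simp only [extendLast, Matrix.of_apply, Matrix.one_apply, Prod.mk.injEq,
    config_eq_iff]
  split_ifs <;> tauto

lemma extendLast_mul {M : ℕ}
    (X Y : Matrix (Fin 2 × (Fin M → Fin 2)) (Fin 2 × (Fin M → Fin 2)) ℂ) :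
    extendLast (X * Y) = extendLast X * extendLast Y := by
  ext ⟨a, s⟩ ⟨b, t⟩
  simp only [extendLast, Matrix.of_apply, Matrix.mul_apply, Fintype.sum_prod_type,
    sum_config_succ, Fin.snoc_last, Fin.init_snoc]
  rw [Finset.sum_congr rfl fun c _ => Finset.sum_comm]
  simp only [ite_mul, zero_mul, mul_ite, mul_zero]
  simp

lemma extendLast_siteOp {M : ℕ}
    (Lm : Fin (M + 1) → Matrix (Fin 2 × Fin 2) (Fin 2 × Fin 2) ℂ) (j : Fin M) :
    extendLast (siteOp M (fun i => Lm i.castSucc) j) = siteOp (M + 1) Lm j.castSucc := by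
  ext ⟨a, s⟩ ⟨b, t⟩
  have hiff : (∀ i, i ≠ j.castSucc → s i = t i) ↔
      (∀ i, i ≠ j → Fin.init s i = Fin.init t i) ∧ s (Fin.last M) = t (Fin.last M) := by
    simp only [Fin.forall_fin_succ', Fin.init]
    simp [(Fin.castSucc_lt_last j).ne']
  simp only [extendLast, siteOp, Matrix.of_apply, hiff]
  by_cases h : s (Fin.last M) = t (Fin.last M)
  · simp only [h, and_true, if_true]
    rfl
  · simp only [h, and_false, if_false, mul_zero]

lemma monodromy_succ {M : ℕ}
    (Lm : Fin (M + 1) → Matrix (Fin 2 × Fin 2) (Fin 2 × Fin 2) ℂ) :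
    monodromy (M + 1) Lm
      = siteOp (M + 1) Lm (Fin.last M) * extendLast (monodromy M fun i => Lm i.castSucc) := by
  have h : ∀ l : List (Matrix (Fin 2 × (Fin M → Fin 2)) (Fin 2 × (Fin M → Fin 2)) ℂ),
      extendLast l.prod = (l.map extendLast).prod := by
    intro l
    induction l with
    | nil => simp [extendLast_one]
    | cons X l ih => simp [extendLast_mul, ih]
  unfold monodromy
  rw [List.ofFn_succ', List.concat_eq_append, List.reverse_append, h, List.map_reverse,
    List.map_ofFn]
  simp only [List.reverse_singleton, List.singleton_append, List.prod_cons]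
  congr 4
  funext j
  exact (extendLast_siteOp Lm j).symm

lemma monodromy_succ_apply {M : ℕ}
    (Lm : Fin (M + 1) → Matrix (Fin 2 × Fin 2) (Fin 2 × Fin 2) ℂ) (a b : Fin 2)
    (s t : Fin (M + 1) → Fin 2) :
    monodromy (M + 1) Lm (a, s) (b, t)
      = ∑ c, Lm (Fin.last M) (a, s (Fin.last M)) (c, t (Fin.last M))
          * monodromy M (fun i => Lm i.castSucc) (c, Fin.init s) (b, Fin.init t) := by
  have key : ∀ u : Fin M → Fin 2, ∀ c : Fin 2,
      (∀ i, i ≠ Fin.last M → s i = (Fin.snoc u c : Fin (M + 1) → Fin 2) i) ↔ Fin.init s = u := by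
    intro u c
    simp only [Fin.forall_fin_succ', funext_iff, Fin.init]
    simp [(Fin.castSucc_lt_last _).ne]
  rw [monodromy_succ, Matrix.mul_apply, Fintype.sum_prod_type]
  refine Finset.sum_congr rfl fun c _ => ?_
  simp only [sum_config_succ, siteOp, extendLast, Matrix.of_apply, key, Fin.snoc_last,
    Fin.init_snoc]
  simp [mul_ite, Finset.sum_ite_eq]

/-- The lower-right block `⟨1|_a T_a |1⟩_a` of the monodromy. -/
def Dop (M : ℕ) (Lm : Fin M → Matrix (Fin 2 × Fin 2) (Fin 2 × Fin 2) ℂ) :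
    Matrix (Fin M → Fin 2) (Fin M → Fin 2) ℂ :=
  Matrix.of fun s t => monodromy M Lm (1, s) (1, t)

end Monodromy

section Felderhof

variable (t : ℂ) (alpha gamma : ℕ → ℂ)

/-- The `B`-operator of the generalized Felderhof model. -/
abbrev felB (M : ℕ) (z : ℂ) : Matrix (Fin M → Fin 2) (Fin M → Fin 2) ℂ :=
  Bop M fun i => LgenFel z t (alpha ((i : ℕ) + 1)) (gamma ((i : ℕ) + 1))

/-- The `D`-operator of the generalized Felderhof model. -/
abbrev felD (M : ℕ) (z : ℂ) : Matrix (Fin M → Fin 2) (Fin M → Fin 2) ℂ :=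
  Dop M fun i => LgenFel z t (alpha ((i : ℕ) + 1)) (gamma ((i : ℕ) + 1))

lemma felB_zero (z : ℂ) : felB t alpha gamma 0 z = 0 := by
  ext s u
  simp [Bop, monodromy]

lemma felD_zero (z : ℂ) : felD t alpha gamma 0 z = 1 := by
  ext s u
  simp [Dop, monodromy, Matrix.one_apply]

lemma felB_succ (M : ℕ) (z : ℂ) :
    felB t alpha gamma (M + 1) z = lastSiteBlock
      !![(1 - gamma (M + 1) * z) • felB t alpha gamma M z, 0;
         felD t alpha gamma M z, (t + gamma (M + 1) * z) • felB t alpha gamma M z] := by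
  ext s u
  simp only [felB, felD, Bop, Dop, lastSiteBlock, Matrix.of_apply, monodromy_succ_apply,
    Fin.sum_univ_two, Fin.val_last, Fin.val_castSucc]
  generalize s (Fin.last M) = a
  generalize u (Fin.last M) = b
  fin_cases a <;> fin_cases b <;> simp [LgenFel, toPair, pidx]

lemma felD_succ (M : ℕ) (z : ℂ) :
    felD t alpha gamma (M + 1) z = lastSiteBlock
      !![(alpha (M + 1) + (1 - alpha (M + 1) * gamma (M + 1)) * z) • felD t alpha gamma M z,
         ((t + 1) * z) • felB t alpha gamma M z;
         0, (-t * alpha (M + 1) + (1 - alpha (M + 1) * gamma (M + 1)) * z) •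
            felD t alpha gamma M z] := by
  ext s u
  simp only [felB, felD, Bop, Dop, lastSiteBlock, Matrix.of_apply, monodromy_succ_apply,
    Fin.sum_univ_two, Fin.val_last, Fin.val_castSucc]
  generalize s (Fin.last M) = a
  generalize u (Fin.last M) = b
  fin_cases a <;> fin_cases b <;> simp [LgenFel, toPair, pidx]

end Felderhof

section Fermions

/-- The free-fermion creation operator of a one-particle vector `v`, ordered so that a particle
is moved past all the particles to its right. -/
def creation : (M : ℕ) → (Fin M → ℂ) → Matrix (Fin M → Fin 2) (Fin M → Fin 2) ℂ
  | 0, _ => 0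
  | M + 1, v => lastSiteBlock
      !![creation M (Fin.init v), 0; v (Fin.last M) • 1, -creation M (Fin.init v)]

lemma creation_smul {M : ℕ} (c : ℂ) (v : Fin M → ℂ) : creation M (c • v) = c • creation M v := by
  induction M with
  | zero => simp [creation]
  | succ M ih =>
    have h : Fin.init (c • v) = c • Fin.init v := rfl
    simp [creation, h, ih, smul_lastSiteBlock, mul_smul]

lemma creation_anticomm {M : ℕ} (v w : Fin M → ℂ) :
    creation M v * creation M w = -(creation M w * creation M v) := by
  induction M with
  | zero => simp [creation]
  | succ M ih =>
    rw [← neg_one_smul ℂ]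
    simp only [creation, lastSiteBlock_mul, smul_lastSiteBlock]
    congr 1
    simp [ih (Fin.init v) (Fin.init w)]

lemma creation_mulVec_apply {M : ℕ} (v : Fin M → ℂ) (Φ : (Fin M → Fin 2) → ℂ)
    (s : Fin M → Fin 2) :
    (creation M v).mulVec Φ s = ∑ i, if s i = 1 then
      (∏ j, if i < j ∧ s j = 1 then -1 else 1) * (v i * Φ (Function.update s i 0)) else 0 := by
  induction M with
  | zero => simp [creation]
  | succ M ih =>
    obtain ⟨u, c, rfl⟩ : ∃ u c, s = Fin.snoc (α := fun _ => Fin 2) u c :=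
      ⟨_, _, (Fin.snoc_init_self s).symm⟩
    have hsum : ∀ d : Fin 2, ∑ w, creation M (Fin.init v) u w * Φ (Fin.snoc w d) = _ :=
      fun d => ih (Fin.init v) (fun w => Φ (Fin.snoc w d)) u
    simp only [creation, Matrix.mulVec, dotProduct, sum_config_succ, lastSiteBlock,
      Matrix.of_apply, Fin.snoc_last, Fin.init_snoc, Fin.sum_univ_castSucc,
      Fin.prod_univ_castSucc, Fin.snoc_castSucc, Fin.castSucc_lt_castSucc_iff,
      Fin.castSucc_lt_last, ← Fin.snoc_update, Fin.update_snoc_last]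
    fin_cases c
    · simp [hsum, Fin.init]
    · simp [hsum, Fin.init, Matrix.one_apply, add_comm,
        (Fin.castSucc_lt_last _).not_gt]
      rw [← Finset.sum_neg_distrib]
      refine Finset.sum_congr rfl fun i _ => ?_
      split_ifs <;> simp

lemma conf_apply_eq_one_iff {M N : ℕ} (x : Fin N → Fin M) (i : Fin M) :
    conf x i = 1 ↔ ∃ j, x j = i := by
  unfold conf
  split_ifs with h <;> simp [h]

lemma update_conf {M N : ℕ} (x : Fin (N + 1) → Fin M) (hx : Function.Injective x)
    (k : Fin (N + 1)) :
    Function.update (conf x) (x k) 0 = conf (x ∘ k.succAbove) := by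
  funext i
  unfold conf
  by_cases hi : i = x k
  · subst hi
    simp [hx.eq_iff, Fin.succAbove_ne]
  · rw [Function.update_of_ne hi]
    congr 1
    rw [eq_iff_iff, Fin.exists_iff_succAbove k]
    simp [Ne.symm hi]

lemma creation_mulVec_conf {M N : ℕ} (v : Fin M → ℂ) (Φ : (Fin M → Fin 2) → ℂ)
    (x : Fin (N + 1) → Fin M) (hx : StrictMono x) :
    (creation M v).mulVec Φ (conf x)
      = ∑ k : Fin (N + 1), (-1) ^ (k : ℕ) *
          (v (x k.rev) * Φ (conf (x ∘ k.rev.succAbove))) := by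
  have hprod : ∀ F : Fin M → ℂ,
      ∏ j, (if conf x j = 1 then F j else 1) = ∏ k, F (x k) := by
    intro F
    rw [← Finset.prod_filter, ← Finset.prod_image (s := Finset.univ) (g := x) (f := F)
      (hx.injective.injOn)]
    congr 1
    ext i
    simp [conf_apply_eq_one_iff]
  have hsum : ∀ F : Fin M → ℂ,
      ∑ j, (if conf x j = 1 then F j else 0) = ∑ k, F (x k) := by
    intro F
    rw [← Finset.sum_filter, ← Finset.sum_image (s := Finset.univ) (g := x) (f := F)
      (hx.injective.injOn)]
    congr 1
    ext i
    simp [conf_apply_eq_one_iff]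
  have hsign : ∀ k : Fin (N + 1),
      (∏ j, if x k.rev < j ∧ conf x j = 1 then (-1 : ℂ) else 1) = (-1) ^ (k : ℕ) := by
    intro k
    simp only [and_comm (a := x k.rev < _), ite_and]
    rw [hprod fun j => if x k.rev < j then -1 else 1]
    simp only [hx.lt_iff_lt]
    rw [← Finset.prod_filter, Finset.prod_const]
    congr 1
    rw [Finset.filter_lt_eq_Ioi, Fin.card_Ioi, Fin.val_rev]
    omega
  rw [creation_mulVec_apply, hsum, ← Equiv.sum_comp Fin.revPerm]
  simp only [Fin.revPerm_apply, hsign, update_conf x hx.injective]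

lemma creation_prod_vacuum {M N : ℕ} (v : Fin N → Fin M → ℂ) (x : Fin N → Fin M)
    (hx : StrictMono x) :
    (List.ofFn fun j => creation M (v j)).prod.mulVec (Pi.single (fun _ => 0) 1) (conf x)
      = (Matrix.of fun j k => v j (x k.rev)).det := by
  induction N with
  | zero =>
    have : conf x = fun _ => 0 := by
      funext i
      simp [conf]
    simp [this]
  | succ N ih =>
    rw [List.ofFn_succ, List.prod_cons, ← Matrix.mulVec_mulVec, creation_mulVec_conf _ _ _ hx,
      Matrix.det_succ_row_zero]
    refine Finset.sum_congr rfl fun k _ => ?_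
    rw [ih _ _ (hx.comp (Fin.strictMono_succAbove _)), mul_assoc]
    congr 3
    ext i j
    simp [Fin.rev_succAbove]

end Fermions

section Commutation

variable (t : ℂ) (alpha gamma : ℕ → ℂ)

/-- The one-particle wavefunction of the generalized Felderhof model; its entry at the site with
`0`-based index `i` is `f_i(w)`. -/
def oneParticle (M : ℕ) (w : ℂ) : Fin M → ℂ := fun i =>
  (∏ l ∈ Finset.Icc 1 (i : ℕ), (alpha l + (1 - alpha l * gamma l) * w))
    * ∏ l ∈ Finset.Icc ((i : ℕ) + 2) M, (1 - gamma l * w)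

/-- The eigenvalue of the `D`-operator on the vacuum. -/
def vacuumEigenvalue (M : ℕ) (w : ℂ) : ℂ :=
  ∏ l ∈ Finset.Icc 1 M, (alpha l + (1 - alpha l * gamma l) * w)

lemma vacuumEigenvalue_succ (M : ℕ) (w : ℂ) :
    vacuumEigenvalue alpha gamma (M + 1) w = vacuumEigenvalue alpha gamma M w *
      (alpha (M + 1) + (1 - alpha (M + 1) * gamma (M + 1)) * w) :=
  Finset.prod_Icc_succ_top (by omega) _

lemma creation_oneParticle_succ (M : ℕ) (w : ℂ) :
    creation (M + 1) (oneParticle alpha gamma (M + 1) w) = lastSiteBlock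
      !![(1 - gamma (M + 1) * w) • creation M (oneParticle alpha gamma M w), 0;
         vacuumEigenvalue alpha gamma M w • 1,
         -((1 - gamma (M + 1) * w) • creation M (oneParticle alpha gamma M w))] := by
  have hinit : Fin.init (oneParticle alpha gamma (M + 1) w)
      = (1 - gamma (M + 1) * w) • oneParticle alpha gamma M w := by
    funext i
    simp only [Fin.init, oneParticle, Fin.val_castSucc, Pi.smul_apply, smul_eq_mul]
    rw [Finset.prod_Icc_succ_top (by omega)]
    ring
  have hlast : oneParticle alpha gamma (M + 1) w (Fin.last M)
      = vacuumEigenvalue alpha gamma M w := by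
    simp [oneParticle, vacuumEigenvalue]
  rw [creation, hinit, hlast, creation_smul]

lemma felD_felB_mul_creation (M : ℕ) {z w : ℂ} (hzw : z ≠ w) :
    felD t alpha gamma M z * creation M (oneParticle alpha gamma M w)
      = ((z + t * w) / (z - w)) •
          (creation M (oneParticle alpha gamma M w) * felD t alpha gamma M z)
        + (-((1 + t) * z) / (z - w) * vacuumEigenvalue alpha gamma M w) •
          felB t alpha gamma M z ∧
    felB t alpha gamma M z * creation M (oneParticle alpha gamma M w)
      = (-((z + t * w) / (z - w))) •
          (creation M (oneParticle alpha gamma M w) * felB t alpha gamma M z) := by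
  have hne : z - w ≠ 0 := sub_ne_zero.mpr hzw
  induction M with
  | zero => simp [creation, felB_zero]
  | succ M ih =>
    obtain ⟨ihD, ihB⟩ := ih
    rw [felD_succ, felB_succ, creation_oneParticle_succ, vacuumEigenvalue_succ]
    simp only [lastSiteBlock_mul, smul_lastSiteBlock, lastSiteBlock_add]
    generalize felD t alpha gamma M z = D at *
    generalize felB t alpha gamma M z = B at *
    generalize creation M (oneParticle alpha gamma M w) = C at *
    constructor
    · congr 1
      ext a b : 1
      fin_cases a <;> fin_cases b <;>
        simp [Matrix.mul_apply, Fin.sum_univ_two, ihD, ihB]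
      all_goals match_scalars <;> first | ring1 | (field_simp; ring1)
    · congr 1
      ext a b : 1
      fin_cases a <;> fin_cases b <;>
        simp [Matrix.mul_apply, Fin.sum_univ_two, ihD, ihB]
      all_goals match_scalars <;> first | ring1 | (field_simp; ring1)

lemma felB_felD_vacuum (M : ℕ) (z : ℂ) (s : Fin M → Fin 2) :
    felB t alpha gamma M z s (fun _ => 0)
      = creation M (oneParticle alpha gamma M z) s (fun _ => 0) ∧
    felD t alpha gamma M z s (fun _ => 0)
      = vacuumEigenvalue alpha gamma M z *
        (1 : Matrix (Fin M → Fin 2) (Fin M → Fin 2) ℂ) s (fun _ => 0) := by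
  induction M with
  | zero => simp [creation, felB_zero, felD_zero, vacuumEigenvalue]
  | succ M ih =>
    obtain ⟨u, c, rfl⟩ : ∃ u c, s = Fin.snoc (α := fun _ => Fin 2) u c :=
      ⟨_, _, (Fin.snoc_init_self s).symm⟩
    have h0 : Fin.init (fun _ : Fin (M + 1) => (0 : Fin 2)) = fun _ => 0 := rfl
    rw [felD_succ, felB_succ, creation_oneParticle_succ, vacuumEigenvalue_succ]
    simp only [lastSiteBlock, Matrix.of_apply, Fin.snoc_last, Fin.init_snoc, h0]
    fin_cases c <;> simp [ih u, Matrix.one_apply, config_eq_iff, h0]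
    ring_nf

end Commutation

section Wavefunction

variable (t : ℂ) (alpha gamma : ℕ → ℂ)

lemma felB_mul_creation_prod (M n : ℕ) (z : ℂ) (w : Fin n → ℂ) (hzw : ∀ k, z ≠ w k) :
    felB t alpha gamma M z
        * (List.ofFn fun k => creation M (oneParticle alpha gamma M (w k))).prod
      = (∏ k, -((z + t * w k) / (z - w k))) •
        ((List.ofFn fun k => creation M (oneParticle alpha gamma M (w k))).prod
          * felB t alpha gamma M z) := by
  induction n with
  | zero => simp
  | succ n ih =>
    rw [List.ofFn_succ, List.prod_cons, ← mul_assoc,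
      (felD_felB_mul_creation t alpha gamma M (hzw 0)).2, smul_mul_assoc, mul_assoc,
      ih _ fun k => hzw k.succ, Fin.prod_univ_succ, mul_smul_comm, smul_smul, mul_assoc]

lemma creation_mul_creation_prod {M n : ℕ} (u : Fin M → ℂ) (v : Fin n → Fin M → ℂ) :
    creation M u * (List.ofFn fun k => creation M (v k)).prod
      = (-1 : ℂ) ^ n • ((List.ofFn fun k => creation M (v k)).prod * creation M u) := by
  induction n with
  | zero => simp
  | succ n ih =>
    rw [List.ofFn_succ, List.prod_cons, ← mul_assoc, creation_anticomm, neg_mul, mul_assoc, ih,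
      mul_smul_comm, pow_succ, mul_assoc, mul_neg_one, neg_smul]

lemma felB_prod_vacuum (M n : ℕ) (z : Fin n → ℂ) (hz : ∀ j k, j ≠ k → z j ≠ z k) :
    (List.ofFn fun j => felB t alpha gamma M (z j)).prod.mulVec (Pi.single (fun _ => 0) 1)
      = (∏ j, ∏ k, if j < k then (z j + t * z k) / (z j - z k) else 1) •
        (List.ofFn fun j => creation M (oneParticle alpha gamma M (z j))).prod.mulVec
          (Pi.single (fun _ => 0) 1) := by
  induction n with
  | zero => simp
  | succ n ih =>
    have hvac : (felB t alpha gamma M (z 0)).mulVec (Pi.single (fun _ => 0) 1)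
        = (creation M (oneParticle alpha gamma M (z 0))).mulVec (Pi.single (fun _ => 0) 1) := by
      funext s
      simpa using (felB_felD_vacuum t alpha gamma M (z 0) s).1
    rw [List.ofFn_succ, List.ofFn_succ, List.prod_cons, List.prod_cons, ← Matrix.mulVec_mulVec,
      ih _ fun j k hjk => hz _ _ (by simpa using hjk), Matrix.mulVec_smul, Matrix.mulVec_mulVec,
      felB_mul_creation_prod _ _ _ _ _ _ _ fun k => hz _ _ (Fin.succ_ne_zero k).symm,
      Matrix.smul_mulVec, ← Matrix.mulVec_mulVec, hvac, creation_mul_creation_prod,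
      Matrix.smul_mulVec, ← Matrix.mulVec_mulVec, smul_smul, smul_smul]
    congr 1
    rw [Fin.prod_univ_succ, Finset.prod_neg]
    simp [Fin.prod_univ_succ (n := n), Fin.succ_pos]
    ring

end Wavefunction

/-- The wavefunction of the generalized Felderhof model is given by the
generalized factorial Schur functions:  positions are `1`-indexed (`x_j = (x j : ℕ) + 1`)
and `λ_j = x_{N−j+1} − N + j − 1`. -/
theorem generalized_felderhof_wavefunction (t : ℂ) (alpha gamma : ℕ → ℂ)
    (M N : ℕ) (hN : 1 ≤ N) (hMN : N ≤ M)
    (z : Fin N → ℂ) (hz : ∀ j k, j ≠ k → z j ≠ z k)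
    (x : Fin N → Fin M) (hx : StrictMono x) :
    ((List.ofFn fun j : Fin N =>
        Bop M (fun i => LgenFel (z j) t (alpha ((i : ℕ) + 1)) (gamma ((i : ℕ) + 1)))).prod)
        (conf x) (fun _ => 0)
      = (∏ j, ∏ k, if j < k then z j + t * z k else 1)
        * genFactSchur M N alpha gamma
            (fun j => (x (Fin.rev j) : ℕ) + 1 + (j : ℕ) - N) z := by
  have hlam : ∀ k : Fin N,
      (x k.rev : ℕ) + 1 + (k : ℕ) - N + (N - 1 - (k : ℕ)) = (x k.rev : ℕ) := by
    intro k
    have hle : ∀ m (hm : m < N), m ≤ (x ⟨m, hm⟩ : ℕ) := by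
      intro m
      induction m with
      | zero => simp
      | succ m ih =>
        intro hm
        exact (ih (by omega)).trans_lt (hx (Fin.mk_lt_mk.mpr m.lt_succ_self))
    have h := hle k.rev k.rev.isLt
    rw [Fin.eta, Fin.val_rev] at h
    omega
  have hfun := congrFun (felB_prod_vacuum t alpha gamma M N z hz) (conf x)
  rw [Pi.smul_apply, creation_prod_vacuum _ _ hx, Matrix.mulVec_single_one] at hfun
  refine hfun.trans ?_
  simp only [genFactSchur, hlam, smul_eq_mul]
  rw [mul_div_assoc', mul_div_right_comm]
  congr 1
  simp only [← Finset.prod_div_distrib]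
  refine Finset.prod_congr rfl fun j _ => Finset.prod_congr rfl fun k _ => ?_
  split_ifs <;> simp
end
end

section
/- Let N, M ≥ 1, let x₁,…,x_N be nonzero complex numbers and y₁,…,y_M be nonzero complex numbers, generic in the sense that the denominators det_{1≤j,k≤N}(x_k^{N−j+1} − x_k^{−N+j−1}) and det_{1≤j,k≤M}(y_k^{M−j+1} − y_k^{−M+j−1}) are nonzero, and let α₀,…,α_{N+M}, γ₀,…,γ_{N+M} ∈ ℂ. Then the dual Cauchy formula for generalized factorial symplectic Schur functions holds: Σ_{λ ⊆ M^N} sp_λ(x | {α̃} | {γ̃}) · sp_{λ̂}(y | {−α̃} | {−γ̃}) = ∏_{j=1}^M y_j^{−N} · ∏_{j=1}^N ∏_{k=1}^M (1 + x_j y_k)(1 + x_j⁻¹ y_k) · ∏_{0≤j<k≤N+M} (1 + α_j(γ_k − γ_j)) · ∏_{1≤j<k≤N+M} (1 − γ_j γ_k), where the sum is over partitions λ with at most N parts each at most M, λ̂_i = |{ j : λ_j ≤ M − i }| for 1 ≤ i ≤ M, {−α̃} = {−α₀,…,−α_{N+M}} and {−γ̃} = {−γ₀,…,−γ_{N+M}}.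 -/
noncomputable section

/-- The function `g_μ(z|{α̃}|{γ̃}) = ∏_{i=0}^{μ}(α_i + (1−α_iγ_i)z) ∏_{i=μ+2}^{T}(1 − γ_iz)
∏_{i=1}^{T}(1 − γ_iz⁻¹)` with `T = N + M` (parameters indexed from `0`). -/
def gSymp (T : ℕ) (alpha gamma : ℕ → ℂ) (mu : ℕ) (z : ℂ) : ℂ :=
  (∏ i ∈ Finset.range (mu + 1), (alpha i + (1 - alpha i * gamma i) * z))
    * (∏ i ∈ Finset.Icc (mu + 2) T, (1 - gamma i * z))
    * ∏ i ∈ Finset.Icc 1 T, (1 - gamma i * z⁻¹)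

/-- The generalized factorial symplectic Schur function in `n` variables,
`sp_λ(z|{α̃}|{γ̃}) = det( g_{λ_j+n−j}(z_k) − g_{λ_j+n−j}(z_k⁻¹) )
/ det( z_k^{n−j+1} − z_k^{−n+j−1} )`. -/
def genSympSchur (T n : ℕ) (alpha gamma : ℕ → ℂ) (lam : Fin n → ℕ) (z : Fin n → ℂ) : ℂ :=
  Matrix.det (Matrix.of fun j k : Fin n =>
      gSymp T alpha gamma (lam j + (n - 1 - (j : ℕ))) (z k)
        - gSymp T alpha gamma (lam j + (n - 1 - (j : ℕ))) ((z k)⁻¹))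
    / Matrix.det (Matrix.of fun j k : Fin n =>
        (z k) ^ (n - (j : ℕ)) - ((z k)⁻¹) ^ (n - (j : ℕ)))

/-- The matrix `(z_k^{r+1} - z_k^{-r-1})_{r,k}`, whose determinant is the Weyl denominator of
type `C`. -/
def sympVandermonde {n : ℕ} (z : Fin n → ℂ) : Matrix (Fin n) (Fin n) ℂ :=
  Matrix.of fun r k => z k ^ ((r : ℕ) + 1) - (z k)⁻¹ ^ ((r : ℕ) + 1)

/-- The matrix `(g_{μ_r}(z_k) - g_{μ_r}(z_k⁻¹))_{r,k}`. -/
def sympMatrix (T : ℕ) (alpha gamma : ℕ → ℂ) {m n : ℕ} (mu : Fin m → ℕ) (z : Fin n → ℂ) :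
    Matrix (Fin m) (Fin n) ℂ :=
  Matrix.of fun r k => gSymp T alpha gamma (mu r) (z k) - gSymp T alpha gamma (mu r) (z k)⁻¹

open Polynomial in
theorem chebyshev_S_monic_natDegree (n : ℕ) :
    (Chebyshev.S ℂ n).Monic ∧ (Chebyshev.S ℂ n).natDegree = n := by
  induction n using Nat.strong_induction_on with
  | _ n ih =>
    match n with
    | 0 => simp
    | 1 => simp [monic_X]
    | n + 2 =>
      obtain ⟨hm, hd⟩ := ih (n + 1) (by omega)
      obtain ⟨hm', hd'⟩ := ih n (by omega)
      have hXm : (X * Chebyshev.S ℂ ((n + 1 : ℕ) : ℤ)).Monic := monic_X.mul hm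
      have hXd : (X * Chebyshev.S ℂ ((n + 1 : ℕ) : ℤ)).natDegree = n + 2 := by
        rw [monic_X.natDegree_mul hm, natDegree_X, hd]; omega
      have hrec : Chebyshev.S ℂ ((n + 2 : ℕ) : ℤ)
          = X * Chebyshev.S ℂ ((n + 1 : ℕ) : ℤ) - Chebyshev.S ℂ (n : ℤ) := by
        push_cast
        exact Chebyshev.S_add_two ℂ n
      have hlt : (Chebyshev.S ℂ (n : ℤ)).natDegree
          < (X * Chebyshev.S ℂ ((n + 1 : ℕ) : ℤ)).natDegree := by
        rw [hd', hXd]; omega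
      rw [hrec]
      exact ⟨hXm.sub_of_left (degree_lt_degree hlt),
        by rw [natDegree_sub_eq_left_of_natDegree_lt hlt, hXd]⟩

open Polynomial in
theorem pow_sub_inv_pow_eq_chebyshev_S {z : ℂ} (hz : z ≠ 0) (n : ℕ) :
    z ^ (n + 1) - z⁻¹ ^ (n + 1) = (z - z⁻¹) * (Chebyshev.S ℂ n).eval (z + z⁻¹) := by
  induction n using Nat.strong_induction_on with
  | _ n ih =>
    match n with
    | 0 => simp
    | 1 => simp; ring
    | n + 2 =>
      have h1 := ih (n + 1) (by omega)
      have h0 := ih n (by omega)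
      push_cast at h1 ⊢
      rw [Chebyshev.S_add_two, eval_sub, eval_mul, eval_X, mul_sub, ← h0, mul_left_comm, ← h1]
      linear_combination (z⁻¹ ^ (n + 1) - z ^ (n + 1)) * mul_inv_cancel₀ hz

theorem det_sympVandermonde {n : ℕ} (z : Fin n → ℂ) (hz : ∀ k, z k ≠ 0) :
    (sympVandermonde z).det = (∏ k, (z k - (z k)⁻¹))
      * ∏ i, ∏ j ∈ Finset.Ioi i, ((z j + (z j)⁻¹) - (z i + (z i)⁻¹)) := by
  rw [← Matrix.det_vandermonde (fun k => z k + (z k)⁻¹),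
    Matrix.det_eval_matrixOfPolynomials_eq_det_vandermonde _
      (fun r : Fin n => Polynomial.Chebyshev.S ℂ (r : ℕ))
      (fun r => (chebyshev_S_monic_natDegree r).2) (fun r => (chebyshev_S_monic_natDegree r).1),
    ← Matrix.det_mul_column, ← Matrix.det_transpose]
  congr 1
  ext k r
  simpa [sympVandermonde] using pow_sub_inv_pow_eq_chebyshev_S (hz k) r

/-- Antisymmetric Laurent polynomials of degree at most `n` are combinations of the
`z^j - z^{-j}`, `1 ≤ j ≤ n`. -/
theorem exists_coeff_antisymm_laurent (n : ℕ) (p q : Polynomial ℂ) (hp : p.natDegree ≤ n)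
    (hq : q.natDegree ≤ n) :
    ∃ a : Fin n → ℂ, ∀ z : ℂ, z ≠ 0 →
      p.eval z * q.eval z⁻¹ - p.eval z⁻¹ * q.eval z
        = ∑ r, a r * (z ^ ((r : ℕ) + 1) - z⁻¹ ^ ((r : ℕ) + 1)) := by
  let b : Fin n → ℂˣ → ℂ := fun r z => (z : ℂ) ^ ((r : ℕ) + 1) - (z : ℂ)⁻¹ ^ ((r : ℕ) + 1)
  have hdiff : ∀ d ≤ n, (fun z : ℂˣ => (z : ℂ) ^ d - (z : ℂ)⁻¹ ^ d)
      ∈ Submodule.span ℂ (Set.range b) := by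
    intro d hd
    match d with
    | 0 =>
      convert! Submodule.zero_mem (Submodule.span ℂ (Set.range b)) using 1
      ext z
      simp
    | d + 1 => exact Submodule.subset_span ⟨⟨d, hd⟩, rfl⟩
  have hmono : ∀ i ≤ n, ∀ l ≤ n,
      (fun z : ℂˣ => (z : ℂ) ^ i * (z : ℂ)⁻¹ ^ l - (z : ℂ)⁻¹ ^ i * (z : ℂ) ^ l)
        ∈ Submodule.span ℂ (Set.range b) := by
    intro i hi l hl
    rcases le_total i l with h | h <;> obtain ⟨d, rfl⟩ := Nat.exists_eq_add_of_le h
    · convert! Submodule.neg_mem _ (hdiff d (by omega)) using 1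
      ext z
      have := z.ne_zero
      simp only [Pi.neg_apply, pow_add, inv_pow]
      field_simp
      ring
    · convert! hdiff d (by omega) using 1
      ext z
      have := z.ne_zero
      simp only [pow_add, inv_pow]
      field_simp
  have hmem : (fun z : ℂˣ => p.eval (z : ℂ) * q.eval (z : ℂ)⁻¹ - p.eval (z : ℂ)⁻¹ * q.eval (z : ℂ))
      ∈ Submodule.span ℂ (Set.range b) := by
    have h : (fun z : ℂˣ =>
          p.eval (z : ℂ) * q.eval (z : ℂ)⁻¹ - p.eval (z : ℂ)⁻¹ * q.eval (z : ℂ))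
        = ∑ i ∈ Finset.range (n + 1), ∑ l ∈ Finset.range (n + 1), (p.coeff i * q.coeff l) •
          fun z : ℂˣ => (z : ℂ) ^ i * (z : ℂ)⁻¹ ^ l - (z : ℂ)⁻¹ ^ i * (z : ℂ) ^ l := by
      ext z
      simp only [Polynomial.eval_eq_sum_range' (Nat.lt_succ_of_le hp),
        Polynomial.eval_eq_sum_range' (Nat.lt_succ_of_le hq), Finset.sum_mul_sum,
        ← Finset.sum_sub_distrib, Finset.sum_apply, Pi.smul_apply, smul_eq_mul]
      refine Finset.sum_congr rfl fun i _ => Finset.sum_congr rfl fun l _ => ?_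
      ring
    rw [h]
    exact Submodule.sum_mem _ fun i hi => Submodule.sum_mem _ fun l hl =>
      Submodule.smul_mem _ _ (hmono i (Finset.mem_range_succ_iff.1 hi) l
        (Finset.mem_range_succ_iff.1 hl))
  obtain ⟨a, ha⟩ := (Submodule.mem_span_range_iff_exists_fun ℂ).1 hmem
  refine ⟨a, fun z hz => ?_⟩
  have := congrFun ha (Units.mk0 z hz)
  simpa [b] using this.symm

open Polynomial in
theorem exists_coeff_gSymp_sub (T : ℕ) (alpha gamma : ℕ → ℂ) {mu : ℕ} (hmu : mu < T) :
    ∃ a : Fin T → ℂ, ∀ z : ℂ, z ≠ 0 →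
      gSymp T alpha gamma mu z - gSymp T alpha gamma mu z⁻¹
        = ∑ r, a r * (z ^ ((r : ℕ) + 1) - z⁻¹ ^ ((r : ℕ) + 1)) := by
  have hlin : ∀ c d : ℂ, (C c + C d * X).natDegree ≤ 1 := fun c d => by compute_degree
  have hprod : ∀ (s : Finset ℕ) (c d : ℕ → ℂ),
      (∏ i ∈ s, (C (c i) + C (d i) * X)).natDegree ≤ s.card := fun s c d =>
    (natDegree_prod_le _ _).trans ((Finset.sum_le_sum fun i _ => hlin _ _).trans (by simp))
  obtain ⟨a, ha⟩ := exists_coeff_antisymm_laurent T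
    ((∏ i ∈ Finset.range (mu + 1), (C (alpha i) + C (1 - alpha i * gamma i) * X))
      * ∏ i ∈ Finset.Icc (mu + 2) T, (C 1 + C (-gamma i) * X))
    (∏ i ∈ Finset.Icc 1 T, (C 1 + C (-gamma i) * X))
    (natDegree_mul_le.trans ((add_le_add (hprod _ _ _) (hprod _ _ _)).trans (by simp; omega)))
    ((hprod _ _ _).trans (by simp))
  refine ⟨a, fun z hz => ?_⟩
  rw [← ha z hz]
  simp [gSymp, eval_prod, sub_eq_add_neg]

/-- The ratio of `det (g_r(z_k) - g_r(z_k⁻¹))` and the Weyl denominator does not depend on `z`. -/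
theorem exists_det_sympMatrix_eq (T : ℕ) (alpha gamma : ℕ → ℂ) :
    ∃ c : ℂ, ∀ z : Fin T → ℂ, (∀ k, z k ≠ 0) →
      (sympMatrix T alpha gamma (fun r : Fin T => (r : ℕ)) z).det
        = c * (sympVandermonde z).det := by
  choose a ha using fun r : Fin T => exists_coeff_gSymp_sub T alpha gamma r.isLt
  refine ⟨(Matrix.of a).det, fun z hz => ?_⟩
  rw [← Matrix.det_mul]
  congr 1
  ext r k
  simp [sympMatrix, sympVandermonde, Matrix.mul_apply, ha r _ (hz k)]

/-- The constant relating the empty-partition determinant to the Weyl denominator. -/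
def sympConst (T : ℕ) (alpha gamma : ℕ → ℂ) : ℂ :=
  (∏ j ∈ Finset.range (T + 1), ∏ k ∈ Finset.range (T + 1),
      if j < k then 1 + alpha j * (gamma k - gamma j) else 1)
    * ∏ j ∈ Finset.Icc 1 T, ∏ k ∈ Finset.Icc 1 T, if j < k then 1 - gamma j * gamma k else 1

section FinProducts

variable {R : Type*} [CommMonoid R]

theorem prod_Icc_one_eq_prod_fin (T : ℕ) (F : ℕ → R) :
    ∏ i ∈ Finset.Icc 1 T, F i = ∏ j : Fin T, F (j + 1) := by
  rw [Fin.prod_univ_eq_prod_range (fun j => F (j + 1)) T, Finset.range_eq_Ico,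
    Finset.prod_Ico_add' F 0 T 1]
  rfl

theorem prod_ite_lt_eq_prod_Ioi {T : ℕ} (k : Fin T) (F : Fin T → R) :
    (∏ j, if k < j then F j else 1) = ∏ j ∈ Finset.Ioi k, F j := by
  rw [← Finset.prod_filter]
  congr 1
  ext
  simp

theorem prod_Icc_eq_prod_Ioi {T : ℕ} (k : Fin T) (F : ℕ → R) :
    ∏ i ∈ Finset.Icc ((k : ℕ) + 2) T, F i = ∏ j ∈ Finset.Ioi k, F (j + 1) := by
  rw [← prod_ite_lt_eq_prod_Ioi k fun j => F (j + 1)]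
  have h := prod_Icc_one_eq_prod_fin T fun i => if (k : ℕ) + 1 < i then F i else 1
  simp only [add_lt_add_iff_right, Fin.val_fin_lt] at h
  rw [← h, ← Finset.prod_filter]
  congr 1
  ext i
  simp only [Finset.mem_Icc, Finset.mem_filter]
  omega

theorem prod_prod_eq_diag_mul_prod_Ioi {T : ℕ} (F : Fin T → Fin T → R) :
    ∏ i, ∏ j, F i j = (∏ i, F i i) * ∏ i, ∏ j ∈ Finset.Ioi i, (F i j * F j i) := by
  have hsplit : ∀ i, ∏ j, F i j
      = F i i * ((∏ j ∈ Finset.Ioi i, F i j) * ∏ j ∈ Finset.Iio i, F i j) := by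
    intro i
    have hcompl : ({i}ᶜ : Finset (Fin T)) = Finset.Ioi i ∪ Finset.Iio i := by
      ext j
      simp [eq_comm]
    rw [Fintype.prod_eq_mul_prod_compl i, hcompl, Finset.prod_union]
    exact Finset.disjoint_left.2 fun j h h' =>
      lt_asymm (Finset.mem_Ioi.1 h) (Finset.mem_Iio.1 h')
  have hcomm : ∏ i, ∏ j ∈ Finset.Iio i, F i j = ∏ i, ∏ j ∈ Finset.Ioi i, F j i :=
    Finset.prod_comm' (by simp)
  simp only [hsplit, Finset.prod_mul_distrib, hcomm]

/-- A product over pairs `i < j` in `Fin (m + n)`, split according to the two blocks. -/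
theorem prod_Ioi_fin_add {m n : ℕ} (F : Fin (m + n) → Fin (m + n) → R) :
    ∏ i, ∏ j ∈ Finset.Ioi i, F i j
      = (∏ i : Fin m, ∏ j ∈ Finset.Ioi i, F (Fin.castAdd n i) (Fin.castAdd n j))
        * (∏ i : Fin n, ∏ j ∈ Finset.Ioi i, F (Fin.natAdd m i) (Fin.natAdd m j))
        * ∏ i : Fin m, ∏ j : Fin n, F (Fin.castAdd n i) (Fin.natAdd m j) := by
  have hcc : ∀ i j : Fin m, Fin.castAdd n i < Fin.castAdd n j ↔ i < j := fun i j => Iff.rfl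
  have hcn : ∀ (i : Fin m) (j : Fin n), Fin.castAdd n i < Fin.natAdd m j := fun i j => by
    simp only [Fin.lt_def, Fin.val_castAdd, Fin.val_natAdd]; omega
  simp only [← prod_ite_lt_eq_prod_Ioi, Fin.prod_univ_add, hcn, (hcn _ _).not_gt, if_true, if_false,
    Finset.prod_const_one, mul_one, Finset.prod_mul_distrib, Fin.natAdd_lt_natAdd_iff, hcc]
  rw [mul_assoc, mul_comm (∏ i : Fin m, ∏ j : Fin n, _)]

end FinProducts

theorem sympConst_eq (T : ℕ) (alpha gamma : ℕ → ℂ) :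
    sympConst T alpha gamma
      = (∏ k : Fin T, ∏ i ∈ Finset.range (k + 1), (1 + alpha i * (gamma (k + 1) - gamma i)))
        * ∏ i : Fin T, ∏ j ∈ Finset.Ioi i, (1 - gamma (i + 1) * gamma (j + 1)) := by
  unfold sympConst
  congr 1
  · rw [Finset.prod_comm, Finset.prod_range_succ', Finset.prod_range]
    simp only [not_lt_zero, if_false, Finset.prod_const_one, mul_one]
    refine Finset.prod_congr rfl fun k _ => ?_
    rw [← Finset.prod_filter]
    congr 1
    ext i
    simp only [Finset.mem_filter, Finset.mem_range]
    omega
  · simp only [prod_Icc_one_eq_prod_fin, ← prod_ite_lt_eq_prod_Ioi, add_lt_add_iff_right,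
      Fin.val_fin_lt]

/-- At `z = (γ_1, …, γ_T)` the matrix `(g_r(z_k) - g_r(z_k⁻¹))` is triangular. -/
theorem det_sympMatrix_gamma (T : ℕ) (alpha gamma : ℕ → ℂ)
    (hgamma : ∀ k : Fin T, gamma (k + 1) ≠ 0) :
    (sympMatrix T alpha gamma (fun r : Fin T => (r : ℕ)) (fun k : Fin T => gamma (k + 1))).det
      = sympConst T alpha gamma * (sympVandermonde fun k : Fin T => gamma (k + 1)).det := by
  have hentry : ∀ r k : Fin T,
      sympMatrix T alpha gamma (fun r : Fin T => (r : ℕ)) (fun k : Fin T => gamma (k + 1)) r k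
        = -((∏ i ∈ Finset.range (r + 1),
              (alpha i + (1 - alpha i * gamma i) * (gamma (k + 1))⁻¹))
            * (∏ j ∈ Finset.Ioi r, (1 - gamma (j + 1) * (gamma (k + 1))⁻¹))
            * ∏ j : Fin T, (1 - gamma (j + 1) * gamma (k + 1))) := by
    intro r k
    have h0 : ∏ j : Fin T, (1 - gamma (j + 1) * (gamma (k + 1))⁻¹) = 0 :=
      Finset.prod_eq_zero (Finset.mem_univ k) (by rw [mul_inv_cancel₀ (hgamma k), sub_self])
    simp only [sympMatrix, gSymp, Matrix.of_apply, prod_Icc_one_eq_prod_fin, inv_inv, h0,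
      prod_Icc_eq_prod_Ioi, mul_zero, zero_sub]
  rw [Matrix.det_of_isLowerTriangular]
  swap
  · intro r k hrk
    rw [hentry, Finset.prod_eq_zero (s := Finset.Ioi r) (i := k), mul_zero, zero_mul, neg_zero]
    · simpa using hrk
    · rw [mul_inv_cancel₀ (hgamma k), sub_self]
  have hnum : ∀ k : Fin T,
      ∏ i ∈ Finset.range (k + 1), (alpha i + (1 - alpha i * gamma i) * (gamma (k + 1))⁻¹)
        = (∏ i ∈ Finset.range (k + 1), (1 + alpha i * (gamma (k + 1) - gamma i)))
          * ((gamma (k + 1))⁻¹ * ∏ _j ∈ Finset.Iio k, (gamma (k + 1))⁻¹) := by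
    intro k
    rw [Finset.prod_const, Fin.card_Iio, ← pow_succ', ← Finset.card_range (k + 1 : ℕ),
      ← Finset.prod_const, Finset.card_range, ← Finset.prod_mul_distrib]
    refine Finset.prod_congr rfl fun i _ => ?_
    have := hgamma k
    field_simp
    ring
  have hcomm : ∏ k : Fin T, ∏ _j ∈ Finset.Iio k, (gamma (k + 1))⁻¹
      = ∏ i : Fin T, ∏ j ∈ Finset.Ioi i, (gamma (j + 1))⁻¹ := Finset.prod_comm' (by simp)
  rw [det_sympVandermonde _ hgamma, sympConst_eq]
  simp only [hentry, hnum, neg_eq_neg_one_mul (_ * _), Finset.prod_mul_distrib, hcomm,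
    prod_prod_eq_diag_mul_prod_Ioi (fun k j : Fin T => 1 - gamma (j + 1) * gamma (k + 1))]
  have hdiag : ∏ k : Fin T, (gamma (k + 1) - (gamma (k + 1))⁻¹)
      = (∏ _k : Fin T, (-1 : ℂ)) * (∏ k : Fin T, (gamma (k + 1))⁻¹)
        * ∏ k : Fin T, (1 - gamma (k + 1) * gamma (k + 1)) := by
    simp only [← Finset.prod_mul_distrib]
    refine Finset.prod_congr rfl fun k _ => ?_
    have := hgamma k
    field_simp
    ring
  have hpair : ∏ i : Fin T, ∏ j ∈ Finset.Ioi i,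
        ((gamma (j + 1) + (gamma (j + 1))⁻¹) - (gamma (i + 1) + (gamma (i + 1))⁻¹))
      = (∏ i : Fin T, ∏ j ∈ Finset.Ioi i, (gamma (j + 1))⁻¹)
        * (∏ i : Fin T, ∏ j ∈ Finset.Ioi i, (1 - gamma (j + 1) * (gamma (i + 1))⁻¹))
        * ∏ i : Fin T, ∏ j ∈ Finset.Ioi i, (1 - gamma (j + 1) * gamma (i + 1)) := by
    simp only [← Finset.prod_mul_distrib]
    refine Finset.prod_congr rfl fun i _ => Finset.prod_congr rfl fun j _ => ?_
    have := hgamma i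
    have := hgamma j
    field_simp
    ring
  rw [hdiag, hpair]
  ring

theorem finite_setOf_quadratic_eq_zero {a b c : ℂ} (h : a ≠ 0 ∨ b ≠ 0) :
    {t : ℂ | a * t ^ 2 + b * t + c = 0}.Finite := by
  let p : Polynomial ℂ := .C a * .X ^ 2 + .C b * .X + .C c
  have hp : p ≠ 0 := by
    intro h0
    have h1 : p.coeff 1 = b := by simp [p, Polynomial.coeff_C]
    have h2 : p.coeff 2 = a := by simp [p]
    rw [h0, Polynomial.coeff_zero] at h1 h2
    rcases h with h | h
    exacts [h h2.symm, h h1.symm]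
  refine (Polynomial.finite_setOfPred_isRoot hp).subset fun t ht => ?_
  simpa [p, Polynomial.IsRoot] using ht

theorem det_sympMatrix_of_generic (T : ℕ) (alpha gamma : ℕ → ℂ)
    (hne : ∀ k : Fin T, gamma (k + 1) ≠ 0)
    (hinj : ∀ i j : Fin T, i ≠ j → gamma (i + 1) ≠ gamma (j + 1))
    (hmul : ∀ i j : Fin T, gamma (i + 1) * gamma (j + 1) ≠ 1)
    (z : Fin T → ℂ) (hz : ∀ k, z k ≠ 0) :
    (sympMatrix T alpha gamma (fun r : Fin T => (r : ℕ)) z).det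
      = sympConst T alpha gamma * (sympVandermonde z).det := by
  obtain ⟨c, hc⟩ := exists_det_sympMatrix_eq T alpha gamma
  have hV : (sympVandermonde fun k : Fin T => gamma (k + 1)).det ≠ 0 := by
    rw [det_sympVandermonde _ hne]
    refine mul_ne_zero (Finset.prod_ne_zero_iff.2 fun k _ h => hmul k k ?_)
      (Finset.prod_ne_zero_iff.2 fun i _ => Finset.prod_ne_zero_iff.2 fun j hj h => ?_)
    · have := hne k
      field_simp at h
      linear_combination h
    · have hij : (gamma (j + 1) - gamma (i + 1)) * (gamma (i + 1) * gamma (j + 1) - 1) = 0 := by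
        have := hne i
        have := hne j
        field_simp at h
        linear_combination h
      rcases mul_eq_zero.1 hij with h | h
      · exact hinj j i (Finset.mem_Ioi.1 hj).ne' (sub_eq_zero.1 h)
      · exact hmul i j (sub_eq_zero.1 h)
  rw [hc z hz, mul_right_cancel₀ hV ((hc _ hne).symm.trans (det_sympMatrix_gamma T alpha gamma hne))]

/-- The determinant for the empty partition in `T` variables. -/
theorem det_sympMatrix (T : ℕ) (alpha gamma : ℕ → ℂ) (z : Fin T → ℂ) (hz : ∀ k, z k ≠ 0) :
    (sympMatrix T alpha gamma (fun r : Fin T => (r : ℕ)) z).det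
      = sympConst T alpha gamma * (sympVandermonde z).det := by
  let G : ℂ → ℕ → ℂ := fun t i => gamma i + t * i
  let bad : Set ℂ := ⋃ (i : Fin T) (j : Fin T),
    {t | G t (i + 1) = 0} ∪ {t | i ≠ j ∧ G t (i + 1) = G t (j + 1)}
      ∪ {t | G t (i + 1) * G t (j + 1) = 1}
  have hbad : bad.Finite := by
    refine Set.finite_iUnion fun i => Set.finite_iUnion fun j => ((Set.Finite.union ?_ ?_).union ?_)
    · refine (finite_setOf_quadratic_eq_zero (a := 0) (b := (i : ℂ) + 1) (c := gamma (i + 1))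
        (Or.inr (Nat.cast_add_one_ne_zero _))).subset fun t ht => ?_
      simp only [G, Set.mem_ofPred_eq, Nat.cast_add, Nat.cast_one] at ht ⊢
      linear_combination ht
    · by_cases hij : i = j
      · simp [hij]
      · refine (finite_setOf_quadratic_eq_zero (a := 0) (b := (i : ℂ) - j)
          (c := gamma (i + 1) - gamma (j + 1)) (Or.inr ?_)).subset fun t ht => ?_
        · simpa [sub_eq_zero, Fin.ext_iff] using hij
        · have ht := ht.2
          simp only [G, Set.mem_ofPred_eq, Nat.cast_add, Nat.cast_one] at ht ⊢
          linear_combination ht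
    · refine (finite_setOf_quadratic_eq_zero (a := ((i : ℂ) + 1) * ((j : ℂ) + 1))
        (b := gamma (i + 1) * ((j : ℂ) + 1) + gamma (j + 1) * ((i : ℂ) + 1))
        (c := gamma (i + 1) * gamma (j + 1) - 1)
        (Or.inl (mul_ne_zero (Nat.cast_add_one_ne_zero _) (Nat.cast_add_one_ne_zero _)))).subset
          fun t ht => ?_
      simp only [G, Set.mem_ofPred_eq, Nat.cast_add, Nat.cast_one] at ht ⊢
      linear_combination ht
  have hcontL : Continuous fun t => (sympMatrix T alpha (G t) (fun r : Fin T => (r : ℕ)) z).det := by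
    refine Continuous.matrix_det (continuous_matrix fun r k => ?_)
    simp only [sympMatrix, gSymp, Matrix.of_apply, G]
    fun_prop
  have hcontR : Continuous fun t => sympConst T alpha (G t) * (sympVandermonde z).det := by
    simp only [sympConst_eq, G]
    fun_prop
  have heq : (fun t => (sympMatrix T alpha (G t) (fun r : Fin T => (r : ℕ)) z).det)
      = fun t => sympConst T alpha (G t) * (sympVandermonde z).det := by
    refine Continuous.ext_on (hbad.countable.dense_compl ℂ) hcontL hcontR fun t ht => ?_
    simp only [bad, Set.mem_compl_iff, Set.mem_iUnion, Set.mem_union, Set.mem_ofPred_eq, not_exists,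
      not_or, not_and] at ht
    exact det_sympMatrix_of_generic T alpha (G t) (fun k => (ht k k).1.1)
      (fun i j => (ht i j).1.2) (fun i j => (ht i j).2) z hz
  simpa [G] using congrFun heq 0

theorem det_sympVandermonde_append {m n : ℕ} (x : Fin m → ℂ) (y : Fin n → ℂ)
    (hx : ∀ j, x j ≠ 0) (hy : ∀ k, y k ≠ 0) :
    (sympVandermonde (Fin.append x y)).det
      = (sympVandermonde x).det * (sympVandermonde y).det
        * ∏ j, ∏ k, ((y k + (y k)⁻¹) - (x j + (x j)⁻¹)) := by
  have hxy : ∀ k, Fin.append x y k ≠ 0 := fun k =>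
    Fin.addCases (fun j => by simpa using hx j) (fun j => by simpa using hy j) k
  rw [det_sympVandermonde _ hxy, det_sympVandermonde _ hx, det_sympVandermonde _ hy,
    Fin.prod_univ_add, prod_Ioi_fin_add]
  simp only [Fin.append_left, Fin.append_right]
  ring

/-- Laplace expansion along a set `B` of columns, as a sum over the possible sets `S` of rows. -/
theorem det_eq_sum_det_blocks {n R : Type*} [Fintype n] [DecidableEq n] [CommRing R]
    (A : Matrix n n R) (B : Finset n) :
    A.det = ∑ S ∈ Finset.powersetCard B.card Finset.univ,
      (Matrix.of fun r c => if r ∈ S ↔ c ∈ B then A r c else 0).det := by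
  simp only [Matrix.det_apply', Matrix.of_apply]
  rw [Finset.sum_comm]
  refine Finset.sum_congr rfl fun σ _ => ?_
  rw [Finset.sum_eq_single (B.map σ.toEmbedding)]
  · simp
  · intro S _ hS
    obtain ⟨i, hi⟩ : ∃ i, ¬(σ i ∈ S ↔ i ∈ B) := by
      by_contra! h
      refine hS (Finset.ext fun r => ?_)
      obtain ⟨i, rfl⟩ := σ.surjective r
      simpa using h i
    rw [Finset.prod_eq_zero (Finset.mem_univ i) (if_neg hi), mul_zero]
  · intro h
    exact absurd (by simp [Finset.mem_powersetCard]) h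

theorem det_blocks_eq {m n : ℕ} {R : Type*} [CommRing R]
    (A : Matrix (Fin (m + n)) (Fin (m + n)) R) (σ : Equiv.Perm (Fin (m + n)))
    (s : Fin m → Fin (m + n)) (c : Fin n → Fin (m + n))
    (hs : ∀ j, σ (Fin.castAdd n j) = s j) (hc : ∀ i, σ (Fin.natAdd m i) = c i) :
    (Matrix.of fun r k => if r ∈ Finset.univ.image s
        ↔ k ∈ Finset.univ.image (Fin.castAdd n : Fin m → Fin (m + n)) then A r k else 0).det
      = σ.sign * ((A.submatrix s (Fin.castAdd n)).det * (A.submatrix c (Fin.natAdd m)).det) := by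
  set D : Matrix (Fin (m + n)) (Fin (m + n)) R := Matrix.of fun r k =>
    if r ∈ Finset.univ.image s
      ↔ k ∈ Finset.univ.image (Fin.castAdd n : Fin m → Fin (m + n)) then A r k else 0 with hD
  have hnat : ∀ i : Fin n,
      Fin.natAdd m i ∉ Finset.univ.image (Fin.castAdd n : Fin m → Fin (m + n)) := by
    intro i hi
    obtain ⟨j, -, hj⟩ := Finset.mem_image.1 hi
    have := congrArg Fin.val hj
    simp at this
    omega
  have hcs : ∀ i, c i ∉ Finset.univ.image s := by
    intro i hi
    obtain ⟨j, -, hj⟩ := Finset.mem_image.1 hi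
    rw [← hs, ← hc] at hj
    exact hnat i (σ.injective hj ▸ Finset.mem_image_of_mem _ (Finset.mem_univ j))
  have hblocks : (D.submatrix σ id).submatrix finSumFinEquiv finSumFinEquiv
      = Matrix.fromBlocks (A.submatrix s (Fin.castAdd n)) 0 0 (A.submatrix c (Fin.natAdd m)) := by
    ext (r | r) (k | k) <;>
      simp only [hD, Matrix.submatrix_apply, Matrix.of_apply, finSumFinEquiv_apply_left,
        finSumFinEquiv_apply_right, id_eq, hs, hc, hcs, hnat, Finset.mem_image_of_mem,
        Finset.mem_univ, Matrix.fromBlocks_apply₁₁, Matrix.fromBlocks_apply₁₂,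
        Matrix.fromBlocks_apply₂₁, Matrix.fromBlocks_apply₂₂, Matrix.zero_apply, iff_false,
        iff_true, not_true, if_true, if_false]
  rw [← Matrix.det_fromBlocks_zero₂₁, ← hblocks, Matrix.det_submatrix_equiv_self,
    Matrix.det_permute, ← mul_assoc]
  norm_cast
  simp

section Partitions

variable {N M : ℕ}

/-- The elements of `λ + δ` in increasing order, for `λ` given by `f`. -/
def shiftedParts (f : Fin N → Fin (M + 1)) (j : Fin N) : Fin (N + M) :=
  ⟨f j.rev + j, by have := (f j.rev).isLt; have := j.isLt; omega⟩

/-- The number of parts of `λ` that are at most `i`. -/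
def smallPartsCount (f : Fin N → Fin (M + 1)) (i : Fin M) : ℕ :=
  (Finset.univ.filter fun j : Fin N => (f j : ℕ) ≤ i).card

/-- The elements of `λ̂ + δ` in increasing order. -/
def shiftedDualParts (f : Fin N → Fin (M + 1)) (i : Fin M) : Fin (N + M) :=
  ⟨smallPartsCount f i + i, by
    have : smallPartsCount f i ≤ N := (Finset.card_filter_le _ _).trans (by simp)
    have := i.isLt
    omega⟩

theorem shiftedParts_strictMono {f : Fin N → Fin (M + 1)} (hf : Antitone f) :
    StrictMono (shiftedParts f) := by
  intro j k hjk
  have h : f j.rev ≤ f k.rev := hf (Fin.rev_le_rev.2 hjk.le)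
  simp only [shiftedParts, Fin.lt_def, Fin.le_def] at *
  omega

theorem shiftedDualParts_strictMono (f : Fin N → Fin (M + 1)) :
    StrictMono (shiftedDualParts f) := by
  intro i k hik
  have h : smallPartsCount f i ≤ smallPartsCount f k :=
    Finset.card_le_card (Finset.monotone_filter_right _ fun j _ hj => hj.trans hik.le)
  simp only [shiftedDualParts, Fin.lt_def] at *
  omega

theorem le_iff_lt_smallPartsCount {f : Fin N → Fin (M + 1)} (hf : Antitone f) (j : Fin N)
    (i : Fin M) : (f j.rev : ℕ) ≤ i ↔ (j : ℕ) < smallPartsCount f i := by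
  have hj := j.isLt
  constructor
  · intro h
    have hsub : Finset.Ici j.rev ⊆ Finset.univ.filter fun j : Fin N => (f j : ℕ) ≤ i :=
      fun k hk => Finset.mem_filter.2 ⟨Finset.mem_univ k,
        (Fin.le_def.1 (hf (Finset.mem_Ici.1 hk))).trans h⟩
    have hcard := Finset.card_le_card hsub
    rw [Fin.card_Ici, Fin.val_rev] at hcard
    unfold smallPartsCount
    omega
  · intro h
    by_contra! hlt
    have hsub : (Finset.univ.filter fun j : Fin N => (f j : ℕ) ≤ i) ⊆ Finset.Ioi j.rev := by
      intro k hk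
      rw [Finset.mem_Ioi]
      by_contra! hkj
      have h1 := Fin.le_def.1 (hf hkj)
      have h2 := (Finset.mem_filter.1 hk).2
      omega
    have hcard := Finset.card_le_card hsub
    rw [Fin.card_Ioi, Fin.val_rev] at hcard
    unfold smallPartsCount at h
    omega

theorem shiftedParts_lt_shiftedDualParts_iff {f : Fin N → Fin (M + 1)} (hf : Antitone f)
    (j : Fin N) (i : Fin M) :
    shiftedParts f j < shiftedDualParts f i ↔ (f j.rev : ℕ) ≤ i := by
  have h := le_iff_lt_smallPartsCount hf j i
  simp only [shiftedParts, shiftedDualParts, Fin.lt_def]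
  omega

theorem shiftedParts_ne_shiftedDualParts {f : Fin N → Fin (M + 1)} (hf : Antitone f)
    (j : Fin N) (i : Fin M) : shiftedParts f j ≠ shiftedDualParts f i := by
  have h := le_iff_lt_smallPartsCount hf j i
  simp only [shiftedParts, shiftedDualParts, Ne, Fin.ext_iff]
  omega

/-- The Grassmannian permutation of the partition given by `f`, together with its sign. -/
theorem exists_perm_shiftedParts {f : Fin N → Fin (M + 1)} (hf : Antitone f) :
    ∃ σ : Equiv.Perm (Fin (N + M)), (∀ j, σ (Fin.castAdd M j) = shiftedParts f j)
      ∧ (∀ i, σ (Fin.natAdd N i) = shiftedDualParts f i)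
      ∧ σ.sign = (-1) ^ (N * M) * ∏ i, (-1) ^ smallPartsCount f i := by
  have hinj : Function.Injective (Fin.append (shiftedParts f) (shiftedDualParts f)) :=
    Fin.append_injective_iff.2 ⟨(shiftedParts_strictMono hf).injective,
      (shiftedDualParts_strictMono f).injective, shiftedParts_ne_shiftedDualParts hf⟩
  let σ : Equiv.Perm (Fin (N + M)) := Equiv.ofBijective _ (Finite.injective_iff_bijective.1 hinj)
  have hσs : ∀ j, σ (Fin.castAdd M j) = shiftedParts f j := fun j => by simp [σ]
  have hσc : ∀ i, σ (Fin.natAdd N i) = shiftedDualParts f i := fun i => by simp [σ]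
  refine ⟨σ, hσs, hσc, ?_⟩
  have hcross : ∀ i : Fin M,
      (∏ j : Fin N, if (f j.rev : ℕ) ≤ i then (1 : ℤˣ) else -1)
        = (-1) ^ N * (-1) ^ smallPartsCount f i := by
    intro i
    refine (Equiv.prod_comp Fin.revPerm
      fun j : Fin N => if (f j : ℕ) ≤ i then (1 : ℤˣ) else -1).trans ?_
    have : ∀ j : Fin N, (if (f j : ℕ) ≤ i then (1 : ℤˣ) else -1)
        = -1 * if (f j : ℕ) ≤ i then -1 else 1 := fun j => by split_ifs <;> simp
    simp only [this, Finset.prod_mul_distrib, ← Finset.prod_filter, Finset.prod_const,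
      Finset.card_univ, Fintype.card_fin]
    rfl
  rw [Equiv.Perm.sign_eq_prod_prod_Ioi, prod_Ioi_fin_add]
  simp only [hσs, hσc, (shiftedParts_strictMono hf).lt_iff_lt,
    (shiftedDualParts_strictMono f).lt_iff_lt, shiftedParts_lt_shiftedDualParts_iff hf]
  rw [Finset.prod_eq_one fun i _ => Finset.prod_eq_one fun j hj => if_pos (Finset.mem_Ioi.1 hj),
    Finset.prod_eq_one fun i _ => Finset.prod_eq_one fun j hj => if_pos (Finset.mem_Ioi.1 hj),
    one_mul, one_mul, Finset.prod_comm]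
  simp only [hcross, Finset.prod_mul_distrib, Finset.prod_const, Finset.card_univ,
    Fintype.card_fin, pow_mul]

/-- Partitions inside an `N × M` box correspond to `N`-subsets of `Fin (N + M)`. -/
theorem sum_antitone_eq_sum_powersetCard {A : Type*} [AddCommMonoid A]
    (F : Finset (Fin (N + M)) → A) :
    ∑ f ∈ Finset.univ.filter
        (fun f : Fin N → Fin (M + 1) => ∀ j k : Fin N, j ≤ k → f k ≤ f j),
      F (Finset.univ.image (shiftedParts f)) = ∑ S ∈ Finset.powersetCard N Finset.univ, F S := by
  refine Finset.sum_nbij (fun f => Finset.univ.image (shiftedParts f)) ?_ ?_ ?_ fun _ _ => rfl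
  · intro f hf
    have hf : Antitone f := fun j k => (Finset.mem_filter.1 hf).2 j k
    rw [Finset.mem_powersetCard]
    exact ⟨Finset.subset_univ _, by
      rw [Finset.card_image_of_injective _ (shiftedParts_strictMono hf).injective, Finset.card_univ,
        Fintype.card_fin]⟩
  · intro f hf g hg hfg
    have hf : Antitone f := fun j k => (Finset.mem_filter.1 (Finset.mem_coe.1 hf)).2 j k
    have hg : Antitone g := fun j k => (Finset.mem_filter.1 (Finset.mem_coe.1 hg)).2 j k
    have hrange : Set.range (shiftedParts f) = Set.range (shiftedParts g) := by
      simpa using congrArg (fun S : Finset (Fin (N + M)) => (S : Set (Fin (N + M)))) hfg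
    have heq := ((shiftedParts_strictMono hf).range_inj (shiftedParts_strictMono hg)).1 hrange
    ext j
    have := congrArg Fin.val (congrFun heq j.rev)
    simpa [shiftedParts] using this
  · intro S hS
    have hcard : S.card = N := (Finset.mem_powersetCard.1 (Finset.mem_coe.1 hS)).2
    let e : Fin N ↪o Fin (N + M) := S.orderEmbOfFin hcard
    have hgap : ∀ j k : Fin N, j ≤ k → (e j : ℕ) + (k - j : ℕ) ≤ e k := by
      intro j k hjk
      have hsub : (Finset.Ico j k).image e ⊆ Finset.Ico (e j) (e k) := by
        intro r hr
        obtain ⟨l, hl, rfl⟩ := Finset.mem_image.1 hr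
        rw [Finset.mem_Ico] at hl ⊢
        exact ⟨e.monotone hl.1, e.strictMono hl.2⟩
      have h := Finset.card_le_card hsub
      rw [Finset.card_image_of_injective _ e.injective, Fin.card_Ico, Fin.card_Ico] at h
      have := Fin.le_def.1 (e.monotone hjk)
      omega
    have hlow : ∀ j : Fin N, (j : ℕ) ≤ e j := by
      intro j
      have := hgap ⟨0, j.pos⟩ j (Fin.le_def.2 (Nat.zero_le _))
      simp only at this
      omega
    have hup : ∀ j : Fin N, (e j : ℕ) - j < M + 1 := by
      intro j
      have h := hgap j ⟨N - 1, by have := j.isLt; omega⟩ (Fin.le_def.2 (by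
        have := j.isLt; simp only; omega))
      have := (e ⟨N - 1, by have := j.isLt; omega⟩).isLt
      simp only at h
      omega
    let f : Fin N → Fin (M + 1) := fun j => ⟨(e j.rev : ℕ) - (j.rev : ℕ), hup _⟩
    refine ⟨f, ?_, ?_⟩
    · simp only [Finset.coe_filter, Finset.mem_univ, true_and, Set.mem_ofPred_eq]
      intro j k hjk
      have h := hgap k.rev j.rev (Fin.rev_le_rev.2 hjk)
      have := hlow k.rev
      have := hlow j.rev
      have := Fin.le_def.1 (Fin.rev_le_rev.2 hjk)
      simp only [f, Fin.le_def]
      omega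
    · have hfe : shiftedParts f = e := by
        ext j
        have := hlow j
        simp only [shiftedParts, f, Fin.rev_rev]
        omega
      simp only [hfe]
      exact Finset.coe_injective (by simp [e])

end Partitions

theorem det_denominator_eq {n : ℕ} (z : Fin n → ℂ) :
    (Matrix.of fun j k : Fin n => z k ^ (n - (j : ℕ)) - (z k)⁻¹ ^ (n - (j : ℕ))).det
      = Equiv.Perm.sign (Fin.revPerm (n := n)) * (sympVandermonde z).det := by
  rw [← Matrix.det_permute]
  congr 1
  ext j k
  have : n - ((j : ℕ) + 1) + 1 = n - j := by omega
  simp [sympVandermonde, Fin.val_rev, this]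

theorem genSympSchur_eq_det_div_det (T n : ℕ) (alpha gamma : ℕ → ℂ) (lam : Fin n → ℕ)
    (z : Fin n → ℂ) :
    genSympSchur T n alpha gamma lam z
      = (sympMatrix T alpha gamma (fun j => lam j.rev + j) z).det / (sympVandermonde z).det := by
  have hnum : (Matrix.of fun j k : Fin n =>
      gSymp T alpha gamma (lam j + (n - 1 - (j : ℕ))) (z k)
        - gSymp T alpha gamma (lam j + (n - 1 - (j : ℕ))) ((z k)⁻¹))
      = (sympMatrix T alpha gamma (fun j => lam j.rev + j) z).submatrix Fin.revPerm id := by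
    ext j k
    simp [sympMatrix, Fin.val_rev, Nat.sub_sub, add_comm 1]
  rw [genSympSchur, hnum, det_denominator_eq, Matrix.det_permute]
  exact mul_div_mul_left _ _ (by norm_cast; exact Units.ne_zero _)

theorem gSymp_neg (T : ℕ) (alpha gamma : ℕ → ℂ) (mu : ℕ) (z : ℂ) :
    gSymp T (fun i => -alpha i) (fun i => -gamma i) mu z
      = (-1) ^ (mu + 1) * gSymp T alpha gamma mu (-z) := by
  have h : ∏ i ∈ Finset.range (mu + 1), (-alpha i + (1 - -alpha i * -gamma i) * z)
      = (-1) ^ (mu + 1)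
        * ∏ i ∈ Finset.range (mu + 1), (alpha i + (1 - alpha i * gamma i) * -z) := by
    rw [← Finset.card_range (mu + 1), ← Finset.prod_const, Finset.card_range,
      ← Finset.prod_mul_distrib]
    exact Finset.prod_congr rfl fun i _ => by ring
  rw [gSymp, gSymp, h]
  simp only [inv_neg, mul_neg, neg_mul, mul_assoc]

theorem det_sympMatrix_neg (T : ℕ) (alpha gamma : ℕ → ℂ) {n : ℕ} (mu : Fin n → ℕ)
    (z : Fin n → ℂ) :
    (sympMatrix T (fun i => -alpha i) (fun i => -gamma i) mu z).det
      = (∏ i, (-1) ^ (mu i + 1)) * (sympMatrix T alpha gamma mu (-z)).det := by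
  rw [← Matrix.det_mul_column]
  congr 1
  ext r k
  simp [sympMatrix, gSymp_neg, mul_sub]

theorem det_sympVandermonde_neg {n : ℕ} (z : Fin n → ℂ) :
    (sympVandermonde (-z)).det = (∏ i : Fin n, (-1) ^ ((i : ℕ) + 1)) * (sympVandermonde z).det := by
  rw [← Matrix.det_mul_column]
  congr 1
  ext r k
  simp [sympVandermonde, neg_pow (z k), neg_pow (z k)⁻¹, mul_sub]

theorem genSympSchur_neg (T n : ℕ) (alpha gamma : ℕ → ℂ) (lam : Fin n → ℕ) (z : Fin n → ℂ) :
    genSympSchur T n (fun i => -alpha i) (fun i => -gamma i) lam z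
      = (∏ i : Fin n, (-1) ^ lam i.rev)
        * ((sympMatrix T alpha gamma (fun j => lam j.rev + j) (-z)).det
          / (sympVandermonde (-z)).det) := by
  have hsign : (∏ i : Fin n, (-1 : ℂ) ^ ((i : ℕ) + 1)) * ∏ i : Fin n, (-1 : ℂ) ^ ((i : ℕ) + 1)
      = 1 := by
    rw [← Finset.prod_mul_distrib]
    exact Finset.prod_eq_one fun i _ => by rw [← mul_pow]; norm_num
  rw [genSympSchur_eq_det_div_det, det_sympMatrix_neg, det_sympVandermonde_neg]
  simp only [add_assoc, pow_add _ (lam _), Finset.prod_mul_distrib]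
  rw [mul_assoc, mul_div_assoc, ← mul_div_mul_left _ (_ * (sympVandermonde z).det)
    (left_ne_zero_of_mul_eq_one hsign), ← mul_assoc _ _ (sympVandermonde z).det, hsign, one_mul]

/-- The dual Cauchy formula for the generalized factorial symplectic
Schur functions.  Partitions `λ ⊆ M^N` are encoded as weakly decreasing functions
`Fin N → Fin (M+1)`, and `λ̂_i = #{ j : λ_j ≤ M − i }`. -/
theorem gen_factorial_symplectic_schur_dual_cauchy (N M : ℕ) (hN : 1 ≤ N) (hM : 1 ≤ M)
    (x : Fin N → ℂ) (y : Fin M → ℂ)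
    (hx0 : ∀ j, x j ≠ 0) (hy0 : ∀ j, y j ≠ 0)
    (hxgen : Matrix.det (Matrix.of fun j k : Fin N =>
        (x k) ^ (N - (j : ℕ)) - ((x k)⁻¹) ^ (N - (j : ℕ))) ≠ 0)
    (hygen : Matrix.det (Matrix.of fun j k : Fin M =>
        (y k) ^ (M - (j : ℕ)) - ((y k)⁻¹) ^ (M - (j : ℕ))) ≠ 0)
    (alpha gamma : ℕ → ℂ) :
    ∑ f ∈ Finset.univ.filter
        (fun f : Fin N → Fin (M + 1) => ∀ j k : Fin N, j ≤ k → f k ≤ f j),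
      genSympSchur (N + M) N alpha gamma (fun j => (f j : ℕ)) x
        * genSympSchur (N + M) M (fun i => -alpha i) (fun i => -gamma i)
            (fun i : Fin M =>
              (Finset.univ.filter (fun j : Fin N => (f j : ℕ) + (i : ℕ) + 1 ≤ M)).card) y
      = (∏ j : Fin M, ((y j)⁻¹) ^ N)
        * (∏ j : Fin N, ∏ k : Fin M, (1 + x j * y k) * (1 + (x j)⁻¹ * y k))
        * (∏ j ∈ Finset.range (N + M + 1), ∏ k ∈ Finset.range (N + M + 1),
            if j < k then 1 + alpha j * (gamma k - gamma j) else 1)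
        * ∏ j ∈ Finset.Icc 1 (N + M), ∏ k ∈ Finset.Icc 1 (N + M),
            if j < k then 1 - gamma j * gamma k else 1 := by
  have hVx : (sympVandermonde x).det ≠ 0 := fun h => hxgen (by rw [det_denominator_eq, h, mul_zero])
  have hVy : (sympVandermonde (-y)).det ≠ 0 := by
    rw [det_sympVandermonde_neg]
    refine mul_ne_zero (Finset.prod_ne_zero_iff.2 fun i _ => pow_ne_zero _ (by norm_num)) fun h => ?_
    exact hygen (by rw [det_denominator_eq, h, mul_zero])
  have hy0' : ∀ k, (-y) k ≠ 0 := fun k => neg_ne_zero.2 (hy0 k)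
  have hz0 : ∀ k, Fin.append x (-y) k ≠ 0 := fun k =>
    Fin.addCases (fun j => by simpa using hx0 j) (fun j => by simpa using hy0 j) k
  set A : Matrix (Fin (N + M)) (Fin (N + M)) ℂ :=
    sympMatrix (N + M) alpha gamma (fun r : Fin (N + M) => (r : ℕ)) (Fin.append x (-y)) with hA
  set B : Finset (Fin (N + M)) := Finset.univ.image (Fin.castAdd M) with hB
  have hBcard : B.card = N := by
    rw [hB, Finset.card_image_of_injective _ (Fin.castAdd_injective N M), Finset.card_univ,
      Fintype.card_fin]
  have hterm : ∀ f ∈ Finset.univ.filter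
      (fun f : Fin N → Fin (M + 1) => ∀ j k : Fin N, j ≤ k → f k ≤ f j),
      genSympSchur (N + M) N alpha gamma (fun j => (f j : ℕ)) x
        * genSympSchur (N + M) M (fun i => -alpha i) (fun i => -gamma i)
            (fun i : Fin M =>
              (Finset.univ.filter (fun j : Fin N => (f j : ℕ) + (i : ℕ) + 1 ≤ M)).card) y
      = (Matrix.of fun r c => if r ∈ Finset.univ.image (shiftedParts f) ↔ c ∈ B
          then A r c else 0).det
        * ((-1) ^ (N * M) / ((sympVandermonde x).det * (sympVandermonde (-y)).det)) := by
    intro f hf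
    obtain ⟨σ, hσs, hσc, hσ⟩ := exists_perm_shiftedParts (f := f)
      fun j k => (Finset.mem_filter.1 hf).2 j k
    have hcount : ∀ i : Fin M,
        (Finset.univ.filter (fun j : Fin N => (f j : ℕ) + (i.rev : ℕ) + 1 ≤ M)).card
          = smallPartsCount f i := by
      intro i
      unfold smallPartsCount
      congr 1
      ext j
      have := i.isLt
      simp only [Fin.val_rev, Finset.mem_filter, Finset.mem_univ, true_and]
      omega
    have hAs : A.submatrix (shiftedParts f) (Fin.castAdd M)
        = sympMatrix (N + M) alpha gamma (fun j : Fin N => (f j.rev : ℕ) + j) x := by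
      ext r k
      simp [hA, sympMatrix, shiftedParts]
    have hAc : A.submatrix (shiftedDualParts f) (Fin.natAdd N)
        = sympMatrix (N + M) alpha gamma (fun i : Fin M => smallPartsCount f i + i) (-y) := by
      ext r k
      simp [hA, sympMatrix, shiftedDualParts]
    have hsq : ((-1 : ℂ) ^ (N * M)) * (-1) ^ (N * M) = 1 := by rw [← mul_pow]; norm_num
    rw [det_blocks_eq A σ _ _ hσs hσc, genSympSchur_eq_det_div_det, genSympSchur_neg, hAs, hAc, hσ]
    simp only [hcount]
    push_cast
    field_simp
    linear_combination
      -((sympMatrix (N + M) alpha gamma (fun j : Fin N => (f j.rev : ℕ) + j) x).det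
        * (∏ i, (-1) ^ smallPartsCount f i)
        * (sympMatrix (N + M) alpha gamma (fun i : Fin M => smallPartsCount f i + i) (-y)).det) * hsq
  have hprod : (-1) ^ (N * M) * ∏ j, ∏ k, (((-y) k + ((-y) k)⁻¹) - (x j + (x j)⁻¹))
      = (∏ j : Fin M, ((y j)⁻¹) ^ N)
        * ∏ j : Fin N, ∏ k : Fin M, (1 + x j * y k) * (1 + (x j)⁻¹ * y k) := by
    have h1 : (-1 : ℂ) ^ (N * M) = ∏ _j : Fin N, ∏ _k : Fin M, (-1 : ℂ) := by
      simp [← pow_mul, mul_comm]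
    have h2 : ∏ j : Fin M, ((y j)⁻¹) ^ N = ∏ _j : Fin N, ∏ k : Fin M, (y k)⁻¹ := by
      rw [Finset.prod_comm]
      simp
    simp only [h1, h2, ← Finset.prod_mul_distrib]
    refine Finset.prod_congr rfl fun j _ => Finset.prod_congr rfl fun k _ => ?_
    have := hx0 j
    have := hy0 k
    simp only [Pi.neg_apply, inv_neg]
    field_simp
    ring
  rw [Finset.sum_congr rfl hterm, ← Finset.sum_mul, sum_antitone_eq_sum_powersetCard
    (fun S => (Matrix.of fun r c => if r ∈ S ↔ c ∈ B then A r c else 0).det)]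
  have hlaplace := det_eq_sum_det_blocks A B
  rw [hBcard] at hlaplace
  rw [← hlaplace, hA, det_sympMatrix _ _ _ _ hz0, det_sympVandermonde_append _ _ hx0 hy0', ← hprod,
    sympConst]
  field_simp
end
end
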